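/- Let (R, m) be a complete Noetherian local ring, a an ideal, and M a finitely generated R-module of dimension n. If N is a submodule of M with Ass(M/N) = Att(H_a^n(M)) and Ass(N) = Ass(M) \ Att(H_a^n(M)), then a + Ann(M/N) is an m-primary ideal and H_a^n(M) ≅ H_m^n(M/N). -/

import Mathlib

noncomputable section

universe u

open CategoryTheory

/-- The `i`-th local cohomology of a module with respect to an ideal. -/
abbrev LC {R : Type u} [CommRing R] (J : Ideal R) (i : ℕ) (M : Type u)
    [AddCommGroup M] [Module R M] : ModuleCat.{u} R :=
  (localCohomology J i).obj (ModuleCat.of R M)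

/-- Attached primes of a module: primes of the form `Ann(T/U)`. -/
def Att (R : Type u) [CommRing R] (T : Type u) [AddCommGroup T] [Module R T] :
    Set (Ideal R) :=
  { p | p.IsPrime ∧ ∃ U : Submodule R T, p = Module.annihilator R (T ⧸ U) }

/-- Krull dimension of a module, as the Krull dimension of its support. -/
def mdim (R : Type u) [CommRing R] (M : Type u) [AddCommGroup M] [Module R M] :
    WithBot ℕ∞ :=
  Order.krullDim (Module.support R M)

/-- Cohomological dimension of `M` with respect to `J`:
the supremum of the `i` with `H_J^i(M) ≠ 0` (`⊥` if there are none). -/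
def cohDim (R : Type u) [CommRing R] (J : Ideal R) (M : Type u)
    [AddCommGroup M] [Module R M] : WithBot ℕ∞ :=
  sSup { x | ∃ i : ℕ, x = (i : ℕ∞) ∧ Nontrivial (LC J i M) }

section part1
universe w v t
open Opposite Abelian

section cmp
set_option linter.unusedSectionVars false
variable {R : Type t} [CommRing R] {C : Type u} [Category.{v} C] [Abelian C] [Linear R C]
  [EnoughProjectives C]

/-- complex in the opposite category computing the old Ext -/
abbrev oldCx {X : C} (P : ProjectiveResolution X) (R : Type t) [CommRing R] [Linear R C] (Y : C) :
    ChainComplex (ModuleCat.{v} R)ᵒᵖ ℕ :=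
  (((linearYoneda R C).obj Y).rightOp.mapHomologicalComplex _).obj P.complex

/-- inclusion of cocycles -/
def oldPm {X : C} (P : ProjectiveResolution X) (n : ℕ) (Y : C) :
    ((oldCx P R Y).opcycles n).unop →ₗ[R] (P.complex.X n ⟶ Y) :=
  ((oldCx P R Y).pOpcycles n).unop.hom

/-- iso of derived functor object with homology -/
def oldIso (R : Type t) [CommRing R] [Linear R C] {X : C} (P : ProjectiveResolution X) (n : ℕ) (Y : C) :
    (((linearYoneda R C).obj Y).rightOp.leftDerived n).obj X ≅ (oldCx P R Y).homology n :=
  P.isoLeftDerivedObj ((linearYoneda R C).obj Y).rightOp n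

/-- class map -/
def oldCl {X : C} (P : ProjectiveResolution X) (n : ℕ) (Y : C) :
    ((oldCx P R Y).opcycles n).unop →ₗ[R] (((_root_.Ext R C n).obj (op X)).obj Y) :=
  ((oldIso R P n Y).hom ≫
    (oldCx P R Y).homologyι n).unop.hom

lemma oldPm_inj {X : C} (P : ProjectiveResolution X) (n : ℕ) (Y : C) :
    Function.Injective (oldPm (R := R) P n Y) :=
  (ModuleCat.mono_iff_injective _).1 (inferInstance : Mono ((oldCx P R Y).pOpcycles n).unop)

lemma oldPm_range {X : C} (P : ProjectiveResolution X) (n : ℕ) (Y : C) (f : P.complex.X n ⟶ Y) :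
    (∃ z, oldPm (R := R) P n Y z = f) ↔ P.complex.d (n + 1) n ≫ f = 0 := by
  have h : (ShortComplex.mk ((oldCx P R Y).d (n+1) n) ((oldCx P R Y).pOpcycles n)
      (HomologicalComplex.d_pOpcycles ..)).Exact :=
    ShortComplex.exact_of_g_is_cokernel _ ((oldCx P R Y).opcyclesIsCokernel (n+1) n (by simp))
  have h2 := (ShortComplex.ShortExact.moduleCat_exact_iff_function_exact _).1 h.unop
  exact (h2 f).symm

lemma oldCl_surj {X : C} (P : ProjectiveResolution X) (n : ℕ) (Y : C) :
    Function.Surjective (oldCl (R := R) P n Y) := by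
  refine (ModuleCat.epi_iff_surjective _).1 (?_ : Epi ((oldIso R P n Y).hom ≫
    (oldCx P R Y).homologyι n).unop)
  infer_instance

lemma oldCl_ker {X : C} (P : ProjectiveResolution X) (n : ℕ) (Y : C) (z) :
    oldCl (R := R) P n Y z = 0 ↔ ∃ g : P.complex.X ((ComplexShape.down ℕ).next n) ⟶ Y,
      oldPm (R := R) P n Y z = P.complex.d n _ ≫ g := by
  have h : (ShortComplex.mk ((oldCx P R Y).homologyι n) ((oldCx P R Y).fromOpcycles n _)
      (by simp)).Exact :=
    ShortComplex.exact_of_f_is_kernel _ ((oldCx P R Y).homologyIsKernel n _ rfl)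
  have h2 := (ShortComplex.ShortExact.moduleCat_exact_iff_function_exact _).1 h.unop
  have h3 : oldCl (R := R) P n Y z = 0 ↔ ((oldCx P R Y).homologyι n).unop.hom z = 0 := by
    have : oldCl (R := R) P n Y z = (oldIso R P n Y).hom.unop.hom (((oldCx P R Y).homologyι n).unop.hom z) := rfl
    rw [this]
    have hi : Function.Injective (oldIso R P n Y).hom.unop.hom :=
      (ModuleCat.mono_iff_injective _).1 inferInstance
    constructor
    · intro h; exact hi (h.trans (map_zero _).symm)
    · intro h; rw [h, map_zero]; rfl
  rw [h3]
  refine (h2 z).trans ⟨?_, ?_⟩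
  · rintro ⟨g, rfl⟩
    refine ⟨g, ?_⟩
    have := congrArg (fun q => q.unop.hom g) ((oldCx P R Y).p_fromOpcycles n ((ComplexShape.down ℕ).next n))
    exact this
  · rintro ⟨g, hg⟩
    refine ⟨g, oldPm_inj (R := R) P n Y ?_⟩
    rw [hg]
    have := congrArg (fun q => q.unop.hom g) ((oldCx P R Y).p_fromOpcycles n ((ComplexShape.down ℕ).next n))
    exact this

lemma old_natY {X : C} (P : ProjectiveResolution X) (n : ℕ) {Y Y' : C} (g : Y ⟶ Y') (z) :
    ∃ z', oldPm (R := R) P n Y' z' = oldPm (R := R) P n Y z ≫ g ∧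
      oldCl P n Y' z' = (((_root_.Ext R C n).obj (op X)).map g).hom (oldCl P n Y z) := by
  let φ : oldCx P R Y' ⟶ oldCx P R Y := (NatTrans.mapHomologicalComplex (((linearYoneda R C).map g).rightOp) _).app P.complex
  refine ⟨(HomologicalComplex.opcyclesMap φ n).unop.hom z, ?_, ?_⟩
  · have := congrArg (fun q => q.unop.hom z) (HomologicalComplex.p_opcyclesMap φ n)
    exact this
  · have h1 : ((_root_.Ext R C n).obj (op X)).map g = ((NatTrans.leftDerived (((linearYoneda R C).map g).rightOp) n).app X).unop := rfl
    have h2 : (NatTrans.leftDerived (((linearYoneda R C).map g).rightOp) n).app X =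
        (oldIso R P n Y').hom ≫ HomologicalComplex.homologyMap φ n ≫ (oldIso R P n Y).inv :=
      P.leftDerived_app_eq (((linearYoneda R C).map g).rightOp) n
    have h3 : (oldIso R P n Y').hom ≫
      (oldCx P R Y').homologyι n ≫ HomologicalComplex.opcyclesMap φ n = (NatTrans.leftDerived (((linearYoneda R C).map g).rightOp) n).app X ≫ (oldIso R P n Y).hom ≫
      (oldCx P R Y).homologyι n := by
      rw [h2, ← HomologicalComplex.homologyι_naturality]
      simp only [Category.assoc, Iso.inv_hom_id_assoc]
    have := congrArg (fun q => q.unop.hom z) h3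
    exact this

lemma old_natX {X X' : C} (P : ProjectiveResolution X) (P' : ProjectiveResolution X') (n : ℕ) {Y : C} (g : X' ⟶ X)
    (ψ : ProjectiveResolution.Hom P' P g) (z) :
    ∃ z', oldPm (R := R) P' n Y z' = ψ.hom.f n ≫ oldPm (R := R) P n Y z ∧
      oldCl P' n Y z' = (((_root_.Ext R C n).map g.op).app Y).hom (oldCl P n Y z) := by
  let F := ((linearYoneda R C).obj Y).rightOp
  let φ : oldCx P' R Y ⟶ oldCx P R Y := (F.mapHomologicalComplex _).map ψ.hom
  refine ⟨(HomologicalComplex.opcyclesMap φ n).unop.hom z, ?_, ?_⟩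
  · have := congrArg (fun q => q.unop.hom z) (HomologicalComplex.p_opcyclesMap φ n)
    exact this
  · have h2 : (F.leftDerived n).map g ≫ (oldIso R P n Y).hom = (oldIso R P' n Y).hom ≫ HomologicalComplex.homologyMap φ n :=
      ProjectiveResolution.isoLeftDerivedObj_hom_naturality g P' P ψ.hom (by
        have := ψ.hom_f_zero_comp_π_f_zero; rwa [ChainComplex.single₀_map_f_zero] at this) F n
    have h3 : (oldIso R P' n Y).hom ≫
      (oldCx P' R Y).homologyι n ≫ HomologicalComplex.opcyclesMap φ n = (F.leftDerived n).map g ≫ (oldIso R P n Y).hom ≫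
      (oldCx P R Y).homologyι n := by
      rw [reassoc_of% h2, ← HomologicalComplex.homologyι_naturality]
    have := congrArg (fun q => q.unop.hom z) h3
    exact this

variable [HasExt.{w} C]

lemma extMk_zero_iff' {X : C} (P : ProjectiveResolution X) (n : ℕ) (Y : C) (f : P.complex.X n ⟶ Y)
    (hf : P.complex.d (n + 1) n ≫ f = 0) :
    P.extMk f (n+1) rfl hf = 0 ↔ ∃ g : P.complex.X ((ComplexShape.down ℕ).next n) ⟶ Y,
      f = P.complex.d n _ ≫ g := by
  cases n with
  | succ p =>
    rw [P.extMk_eq_zero_iff f _ rfl hf p rfl, ChainComplex.next_nat_succ]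
    simp only [eq_comm]
  | zero =>
    simp only [← P.extEquivCohomologyClass.apply_eq_iff_eq,
      ProjectiveResolution.extEquivCohomologyClass_extMk, ProjectiveResolution.extEquivCohomologyClass_zero,
      CochainComplex.HomComplex.CohomologyClass.mk_eq_zero_iff]
    rw [CochainComplex.HomComplex.Cocycle.toSingleMk_mem_coboundaries_iff _ _ _ _ _ 1 (by simp)]
    have hz : Limits.IsZero (P.cochainComplex.X 1) := CochainComplex.isZero_of_isStrictlyLE _ 0 _
    constructor
    · rintro ⟨g, hg⟩
      have : g = 0 := hz.eq_of_src _ _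
      rw [this, Limits.comp_zero] at hg
      refine ⟨0, ?_⟩
      rw [Limits.comp_zero]
      exact (cancel_epi (P.cochainComplexXIso (-((0:ℕ):ℤ)) 0 rfl).hom).1 (by rw [Limits.comp_zero]; exact hg.symm)
    · rintro ⟨g, hg⟩
      refine ⟨0, ?_⟩
      rw [Limits.comp_zero, hg, P.complex.shape, Limits.zero_comp, Limits.comp_zero]
      simp

lemma extMk_smul {X : C} (P : ProjectiveResolution X) (n : ℕ) (Y : C) (f : P.complex.X n ⟶ Y)
    (hf : P.complex.d (n + 1) n ≫ f = 0) (r : R) (h' : P.complex.d (n + 1) n ≫ (r • f) = 0) :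
    P.extMk (r • f) (n+1) rfl h' = r • P.extMk f (n+1) rfl hf := by
  rw [Ext.smul_eq_comp_mk₀, ProjectiveResolution.extMk_comp_mk₀]
  congr 1
  simp

/-- comparison, at cocycle level -/
def newCl {X : C} (P : ProjectiveResolution X) (n : ℕ) (Y : C) :
    ((oldCx P R Y).opcycles n).unop →ₗ[R] Ext X Y n where
  toFun z := P.extMk (oldPm (R := R) P n Y z) (n+1) rfl ((oldPm_range P n Y _).1 ⟨z, rfl⟩)
  map_add' x y := by
    rw [P.add_extMk]
    congr 1
    exact map_add _ _ _
  map_smul' r x := by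
    dsimp
    rw [← extMk_smul]
    · congr 1
      exact map_smul _ _ _
    · rw [Linear.comp_smul, (oldPm_range P n Y _).1 ⟨x, rfl⟩, smul_zero]

lemma newCl_surj {X : C} (P : ProjectiveResolution X) (n : ℕ) (Y : C) :
    Function.Surjective (newCl (R := R) P n Y) := by
  intro e
  obtain ⟨f, hf, rfl⟩ := P.extMk_surjective e (n+1) rfl
  obtain ⟨z, rfl⟩ := (oldPm_range (R := R) P n Y f).2 hf
  exact ⟨z, rfl⟩

lemma cl_ker_eq {X : C} (P : ProjectiveResolution X) (n : ℕ) (Y : C) :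
    LinearMap.ker (newCl (R := R) P n Y) = LinearMap.ker (oldCl (R := R) P n Y) := by
  ext z
  rw [LinearMap.mem_ker, LinearMap.mem_ker, oldCl_ker]
  exact extMk_zero_iff' P n Y _ ((oldPm_range P n Y _).1 ⟨z, rfl⟩)

/-- comparison of the two versions of Ext -/
def cmpExt (R : Type t) [CommRing R] [Linear R C] (n : ℕ) (X Y : C) :
    (((_root_.Ext R C n).obj (op X)).obj Y) ≃ₗ[R] Ext X Y n :=
  ((oldCl (R := R) (projectiveResolution X) n Y).quotKerEquivOfSurjective (oldCl_surj _ _ _)).symm.trans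
    ((Submodule.quotEquivOfEq _ _ (cl_ker_eq _ _ _).symm).trans
    ((newCl (R := R) (projectiveResolution X) n Y).quotKerEquivOfSurjective (newCl_surj _ _ _)))

lemma cmpExt_cl (n : ℕ) (X Y : C) (z) :
    cmpExt R n X Y (oldCl (projectiveResolution X) n Y z) = newCl (projectiveResolution X) n Y z := by
  have : ((oldCl (R := R) (projectiveResolution X) n Y).quotKerEquivOfSurjective (oldCl_surj _ _ _)).symm
    (oldCl (projectiveResolution X) n Y z) = Submodule.Quotient.mk z := by
    rw [LinearEquiv.symm_apply_eq]; rfl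
  simp only [cmpExt, LinearEquiv.trans_apply]
  rw [this]
  rfl

lemma cmpExt_natY (n : ℕ) (X : C) {Y Y' : C} (g : Y ⟶ Y') (e) :
    cmpExt R n X Y' ((((_root_.Ext R C n).obj (op X)).map g).hom e) =
      (cmpExt R n X Y e).comp (Ext.mk₀ g) (add_zero _) := by
  obtain ⟨z, rfl⟩ := oldCl_surj (projectiveResolution X) n Y e
  obtain ⟨z', h1, h2⟩ := old_natY (projectiveResolution X) n g z
  rw [← h2, cmpExt_cl, cmpExt_cl]
  simp only [newCl, LinearMap.coe_mk, AddHom.coe_mk, ProjectiveResolution.extMk_comp_mk₀]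
  congr 1

lemma cmpExt_natX (n : ℕ) {X X' : C} (Y : C) (g : X' ⟶ X) (e) :
    cmpExt R n X' Y ((((_root_.Ext R C n).map g.op).app Y).hom e) =
      (Ext.mk₀ g).comp (cmpExt R n X Y e) (zero_add _) := by
  obtain ⟨z, rfl⟩ := oldCl_surj (projectiveResolution X) n Y e
  let ψ : ProjectiveResolution.Hom (projectiveResolution X') (projectiveResolution X) g :=
    { hom := ProjectiveResolution.lift g _ _
      hom_f_zero_comp_π_f_zero := by
        rw [ChainComplex.single₀_map_f_zero]; exact ProjectiveResolution.lift_commutes_zero .. }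
  obtain ⟨z', h1, h2⟩ := old_natX (projectiveResolution X) (projectiveResolution X') n g ψ z
  rw [← h2, cmpExt_cl, cmpExt_cl]
  simp only [newCl, LinearMap.coe_mk, AddHom.coe_mk]
  rw [ProjectiveResolution.mk₀_comp_extMk _ _ _ _ ψ]
  congr 1

end cmp

end part1

section part2
open Opposite Limits

section
variable {R : Type u} [CommRing R] (J : Ideal R)

/-- `R/J^t` as an object -/
abbrev QM (t : ℕ) : ModuleCat.{u} R := ModuleCat.of R (R ⧸ J ^ t)

/-- the projection `R/J^s → R/J^t` -/
def QMr {t s : ℕ} (h : t ≤ s) : QM J s ⟶ QM J t :=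
  (localCohomology.ringModIdeals (localCohomology.idealPowersDiagram J)).map (homOfLE h).op

/-- the diagram -/
abbrev lcF (i : ℕ) (Y : ModuleCat.{u} R) : (ℕᵒᵖ)ᵒᵖ ⥤ ModuleCat.{u} R :=
  (localCohomology.diagram (localCohomology.idealPowersDiagram J) i) ⋙ (evaluation _ _).obj Y

/-- the canonical cocone -/
def lcCocone (i : ℕ) (Y : ModuleCat.{u} R) : Cocone (lcF J i Y) :=
  ((evaluation _ _).obj Y).mapCocone
    (colimit.cocone (localCohomology.diagram (localCohomology.idealPowersDiagram J) i))

/-- it is a colimit -/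
def lcIsColimit (i : ℕ) (Y : ModuleCat.{u} R) : IsColimit (lcCocone J i Y) :=
  isColimitOfPreserves ((evaluation _ _).obj Y)
    (colimit.isColimit (localCohomology.diagram (localCohomology.idealPowersDiagram J) i))

/-- the old Ext module -/
abbrev oE (i t : ℕ) (Y : ModuleCat.{u} R) : ModuleCat.{u} R :=
  ((_root_.Ext R (ModuleCat.{u} R) i).obj (op (QM J t))).obj Y

/-- structure map for the old Ext -/
def kap (i t : ℕ) (Y : ModuleCat.{u} R) : oE J i t Y ⟶ (localCohomology J i).obj Y :=
  (lcCocone J i Y).ι.app (op (op t))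

/-- restriction -/
def oR (i : ℕ) {t s : ℕ} (h : t ≤ s) (Y : ModuleCat.{u} R) : oE J i t Y ⟶ oE J i s Y :=
  ((_root_.Ext R (ModuleCat.{u} R) i).map (QMr J h).op).app Y

lemma kap_res (i : ℕ) {t s : ℕ} (h : t ≤ s) (Y : ModuleCat.{u} R) :
    oR J i h Y ≫ kap J i s Y = kap J i t Y :=
  (lcCocone J i Y).w (homOfLE h).op.op

instance lc_pres (i : ℕ) (Y : ModuleCat.{u} R) : PreservesColimit (lcF J i Y) (forget (ModuleCat.{u} R)) := by
  haveI : PreservesFilteredColimitsOfSize.{0,0} (forget (ModuleCat.{u} R)) :=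
    preservesSmallestFilteredColimits_of_preservesFilteredColimits.{u,u} _
  infer_instance

lemma kap_surj (i : ℕ) (Y : ModuleCat.{u} R) (x : (localCohomology J i).obj Y) :
    ∃ t e, (kap J i t Y).hom e = x := by
  obtain ⟨j, y, hy⟩ := Concrete.isColimit_exists_rep _ (lcIsColimit J i Y) x
  exact ⟨j.unop.unop, y, hy⟩

lemma kap_zero (i t : ℕ) (Y : ModuleCat.{u} R) (e : oE J i t Y) (he : (kap J i t Y).hom e = 0) :
    ∃ s, ∃ h : t ≤ s, (oR J i h Y).hom e = 0 := by
  have h0 : (kap J i t Y) e = (kap J i t Y) 0 := by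
    rw [map_zero]; exact he
  obtain ⟨k, f, g, hfg⟩ := Concrete.isColimit_exists_of_rep_eq _ (lcIsColimit J i Y) (i := op (op t))
     (j := op (op t)) _ _ h0
  have hle : t ≤ k.unop.unop := leOfHom f.unop.unop
  refine ⟨k.unop.unop, hle, ?_⟩
  have h1 : (oR J i hle Y) e = (oR J i hle Y) 0 := hfg
  rw [map_zero] at h1
  exact h1

lemma kap_nat (i t : ℕ) {Y Y' : ModuleCat.{u} R} (g : Y ⟶ Y') :
    kap J i t Y ≫ (localCohomology J i).map g =
     ((_root_.Ext R (ModuleCat.{u} R) i).obj (op (QM J t))).map g ≫ kap J i t Y' := by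
  exact (((colimit.cocone (localCohomology.diagram (localCohomology.idealPowersDiagram J) i)).ι.app (op (op t))).naturality g).symm

lemma kap_desc (i : ℕ) (Y Z : ModuleCat.{u} R) (f : ∀ t, oE J i t Y ⟶ Z)
    (hf : ∀ t s (h : t ≤ s), oR J i h Y ≫ f s = f t) :
    ∃ F : (localCohomology J i).obj Y ⟶ Z, ∀ t, kap J i t Y ≫ F = f t := by
  let c : Cocone (lcF J i Y) :=
    { pt := Z
      ι := { app := fun j => f j.unop.unop
             naturality := by
              intro j k φ
              have hle : j.unop.unop ≤ k.unop.unop := leOfHom φ.unop.unop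
              refine Eq.trans (hf _ _ hle) ?_
              exact (Category.comp_id _).symm } }
  exact ⟨(lcIsColimit J i Y).desc c, fun t => (lcIsColimit J i Y).fac c (op (op t))⟩

lemma oR_cmp (i : ℕ) {t s : ℕ} (h : t ≤ s) (Y : ModuleCat.{u} R) (e : oE J i t Y) :
    cmpExt R i (QM J s) Y ((oR J i h Y).hom e) =
      (Abelian.Ext.mk₀ (QMr J h)).comp (cmpExt R i (QM J t) Y e) (zero_add _) :=
  cmpExt_natX i Y (QMr J h) e

/-- the structure map -/
def iota (i t : ℕ) (Y : ModuleCat.{u} R) :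
    Abelian.Ext (QM J t) Y i →ₗ[R] (localCohomology J i).obj Y :=
  (kap J i t Y).hom ∘ₗ (cmpExt R i (QM J t) Y).symm.toLinearMap

lemma iota_cmp (i t : ℕ) (Y : ModuleCat.{u} R) (e : oE J i t Y) :
    iota J i t Y (cmpExt R i (QM J t) Y e) = (kap J i t Y).hom e := by
  simp only [iota, LinearMap.comp_apply, LinearEquiv.coe_coe, LinearEquiv.symm_apply_apply]

lemma iota_surj (i : ℕ) (Y : ModuleCat.{u} R) (x : (localCohomology J i).obj Y) :
    ∃ t e, iota J i t Y e = x := by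
  obtain ⟨t, e, h⟩ := kap_surj J i Y x
  exact ⟨t, _, (iota_cmp J i t Y e).trans h⟩

lemma iota_res (i : ℕ) {t s : ℕ} (h : t ≤ s) (Y : ModuleCat.{u} R) (e : Abelian.Ext (QM J t) Y i) :
    iota J i s Y ((Abelian.Ext.mk₀ (QMr J h)).comp e (zero_add _)) = iota J i t Y e := by
  obtain ⟨e, rfl⟩ := (cmpExt R i (QM J t) Y).surjective e
  rw [← oR_cmp, iota_cmp, iota_cmp, ← kap_res J i h Y]
  rfl

lemma iota_zero (i t : ℕ) (Y : ModuleCat.{u} R) (e : Abelian.Ext (QM J t) Y i) (he : iota J i t Y e = 0) :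
    ∃ s, ∃ h : t ≤ s, (Abelian.Ext.mk₀ (QMr J h)).comp e (zero_add _) = 0 := by
  obtain ⟨e, rfl⟩ := (cmpExt R i (QM J t) Y).surjective e
  rw [iota_cmp] at he
  obtain ⟨s, h, h2⟩ := kap_zero J i t Y e he
  refine ⟨s, h, ?_⟩
  rw [← oR_cmp, h2, map_zero]

lemma iota_nat (i t : ℕ) {Y Y' : ModuleCat.{u} R} (g : Y ⟶ Y') (e : Abelian.Ext (QM J t) Y i) :
    ((localCohomology J i).map g).hom (iota J i t Y e) =
      iota J i t Y' (e.comp (Abelian.Ext.mk₀ g) (add_zero _)) := by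
  obtain ⟨e, rfl⟩ := (cmpExt R i (QM J t) Y).surjective e
  rw [← cmpExt_natY, iota_cmp, iota_cmp]
  exact congrArg (fun q => q.hom e) (kap_nat J i t g)

lemma iota_desc (i : ℕ) (Y Z : ModuleCat.{u} R) (f : ∀ t, Abelian.Ext (QM J t) Y i →ₗ[R] Z)
    (hf : ∀ t s (h : t ≤ s) e, f s ((Abelian.Ext.mk₀ (QMr J h)).comp e (zero_add _)) = f t e) :
    ∃ F : (localCohomology J i).obj Y →ₗ[R] Z, ∀ t e, F (iota J i t Y e) = f t e := by
  obtain ⟨F, hF⟩ := kap_desc J i Y Z (fun t => ModuleCat.ofHom (f t ∘ₗ (cmpExt R i (QM J t) Y).toLinearMap)) (by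
    intro t s h
    ext e
    have := hf t s h (cmpExt R i (QM J t) Y e)
    rw [← oR_cmp] at this
    exact this)
  refine ⟨F.hom, fun t e => ?_⟩
  obtain ⟨e, rfl⟩ := (cmpExt R i (QM J t) Y).surjective e
  rw [iota_cmp]
  exact congrArg (fun q => q.hom e) (hF t)

end
end part2

section part3
open Opposite Limits

variable {R : Type u} [CommRing R] (J : Ideal R)

section
variable {X Y Z : Type u} [AddCommGroup X] [AddCommGroup Y] [AddCommGroup Z]
  [Module R X] [Module R Y] [Module R Z]

/-- functoriality of local cohomology -/
def LCmap (i : ℕ) (f : X →ₗ[R] Y) : LC J i X →ₗ[R] LC J i Y :=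
  ((localCohomology J i).map (ModuleCat.ofHom f)).hom

lemma LCmap_id (i : ℕ) : LCmap J i (LinearMap.id : X →ₗ[R] X) = LinearMap.id := by
  have : ModuleCat.ofHom (LinearMap.id : X →ₗ[R] X) = 𝟙 _ := rfl
  rw [LCmap, this, CategoryTheory.Functor.map_id]; rfl

lemma LCmap_comp (i : ℕ) (f : X →ₗ[R] Y) (g : Y →ₗ[R] Z) :
    LCmap J i (g ∘ₗ f) = LCmap J i g ∘ₗ LCmap J i f := by
  rw [LCmap, ModuleCat.ofHom_comp, CategoryTheory.Functor.map_comp]; rfl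

lemma LCmap_iota (i t : ℕ) (f : X →ₗ[R] Y) (e) :
    LCmap J i f (iota J i t (ModuleCat.of R X) e) =
      iota J i t (ModuleCat.of R Y) (e.comp (Abelian.Ext.mk₀ (ModuleCat.ofHom f)) (add_zero _)) :=
  iota_nat J i t _ e

lemma LCmap_smul (i : ℕ) (r : R) (x : LC J i X) :
    LCmap J i (r • (LinearMap.id : X →ₗ[R] X)) x = r • x := by
  obtain ⟨t, e, rfl⟩ := iota_surj J i _ x
  rw [LCmap_iota, ← map_smul, Abelian.Ext.smul_eq_comp_mk₀]
  rfl

lemma LCmap_add (i : ℕ) (f g : X →ₗ[R] Y) (x : LC J i X) :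
    LCmap J i (f + g) x = LCmap J i f x + LCmap J i g x := by
  obtain ⟨t, e, rfl⟩ := iota_surj J i _ x
  rw [LCmap_iota, LCmap_iota, LCmap_iota, ← map_add, ← Abelian.Ext.comp_add, ← Abelian.Ext.mk₀_add]
  rfl

lemma LCmap_zero (i : ℕ) (x : LC J i X) :
    LCmap J i (0 : X →ₗ[R] Y) x = 0 := by
  obtain ⟨t, e, rfl⟩ := iota_surj J i _ x
  rw [LCmap_iota]
  have : ModuleCat.ofHom (0 : X →ₗ[R] Y) = 0 := rfl
  rw [this, Abelian.Ext.mk₀_zero, Abelian.Ext.comp_zero, map_zero]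

/-- isomorphisms -/
def LCequiv (i : ℕ) (e : X ≃ₗ[R] Y) : LC J i X ≃ₗ[R] LC J i Y :=
  LinearEquiv.ofLinearMap (LCmap J i e.toLinearMap) (LCmap J i e.symm.toLinearMap)
    (by rw [← LCmap_comp]; simp [LCmap_id]) (by rw [← LCmap_comp]; simp [LCmap_id])

lemma LC_torsion (i : ℕ) (x : LC J i X) : ∃ t, ∀ r ∈ J ^ t, r • x = 0 := by
  obtain ⟨t, e, rfl⟩ := iota_surj J i _ x
  refine ⟨t, fun r hr => ?_⟩
  rw [← map_smul]
  have h0 : r • 𝟙 (QM J t) = 0 := by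
    ext
    change r • (Ideal.Quotient.mk (J ^ t) 1) = 0
    rw [← Ideal.Quotient.mkₐ_eq_mk R, ← map_smul, smul_eq_mul, mul_one]
    exact Ideal.Quotient.eq_zero_iff_mem.2 hr
  have : r • e = (Abelian.Ext.mk₀ (r • 𝟙 (QM J t))).comp e (zero_add _) := by
    rw [Abelian.Ext.mk₀_smul, Abelian.Ext.smul_comp, Abelian.Ext.mk₀_id_comp]
  rw [this, h0, Abelian.Ext.mk₀_zero, Abelian.Ext.zero_comp, map_zero]

/-- the long exact sequence -/
theorem LC_les (f : X →ₗ[R] Y) (g : Y →ₗ[R] Z) (hf : Function.Injective f)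
    (hg : Function.Surjective g) (hfg : Function.Exact f g) (i : ℕ) :
    ∃ δ : LC J i Z →ₗ[R] LC J (i + 1) X,
      Function.Exact (LCmap J i g) δ ∧ Function.Exact δ (LCmap J (i+1) f) := by
  let S : ShortComplex (ModuleCat.{u} R) := ShortComplex.mk (ModuleCat.ofHom f) (ModuleCat.ofHom g)
    (by ext x; exact hfg.apply_apply_eq_zero x)
  have hS : S.ShortExact :=
    { exact := (ShortComplex.ShortExact.moduleCat_exact_iff_function_exact _).2 hfg
      mono_f := (ModuleCat.mono_iff_injective _).2 hf
      epi_g := (ModuleCat.epi_iff_surjective _).2 hg }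
  obtain ⟨δ, hδ⟩ := iota_desc J i (ModuleCat.of R Z) ((localCohomology J (i+1)).obj (ModuleCat.of R X))
    (fun t => iota J (i+1) t (ModuleCat.of R X) ∘ₗ
      ((Abelian.Ext.bilinearCompOfLinear R (QM J t) S.X₃ S.X₁ i 1 (i+1) rfl).flip hS.extClass)) (by
      intro t s h e
      change iota J (i+1) s (ModuleCat.of R X) ((((Abelian.Ext.mk₀ (QMr J h)).comp e (zero_add _)).comp hS.extClass rfl)) =
        iota J (i+1) t (ModuleCat.of R X) (e.comp hS.extClass rfl)
      rw [← iota_res J (i+1) h, Abelian.Ext.comp_assoc _ _ _ _ _ (by omega)])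
  have hδ' : ∀ t (e : Abelian.Ext (QM J t) S.X₃ i), δ (iota J i t _ e) = iota J (i+1) t S.X₁ (e.comp hS.extClass rfl) := hδ
  refine ⟨δ, ?_, ?_⟩
  · intro z
    constructor
    · intro hz
      obtain ⟨t, e, rfl⟩ := iota_surj J i _ z
      rw [hδ'] at hz
      obtain ⟨s, h, hs⟩ := iota_zero J (i+1) t _ _ hz
      rw [← Abelian.Ext.comp_assoc _ _ _ _ _ (by omega)] at hs
      · obtain ⟨x, hx⟩ := Abelian.Ext.covariant_sequence_exact₃ _ hS _ _ hs
        refine ⟨iota J i s (ModuleCat.of R Y) x, ?_⟩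
        rw [← iota_res J i h, ← hx, LCmap_iota]
      · omega
    · rintro ⟨y, rfl⟩
      obtain ⟨t, e, rfl⟩ := iota_surj J i _ y
      rw [LCmap_iota, hδ']
      have := hS.comp_extClass
      rw [Abelian.Ext.comp_assoc_of_second_deg_zero]
      change iota J (i+1) t S.X₁ (e.comp ((Abelian.Ext.mk₀ S.g).comp hS.extClass _) _) = 0
      rw [this, Abelian.Ext.comp_zero, map_zero]
  · intro z
    constructor
    · intro hz
      obtain ⟨t, e, rfl⟩ := iota_surj J (i+1) _ z
      rw [LCmap_iota] at hz
      obtain ⟨s, h, hs⟩ := iota_zero J (i+1) t _ _ hz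
      rw [← Abelian.Ext.comp_assoc _ _ _ _ _ (by omega)] at hs
      · obtain ⟨x, hx⟩ := Abelian.Ext.covariant_sequence_exact₁ _ hS _ hs rfl
        refine ⟨iota J i s (ModuleCat.of R Z) x, ?_⟩
        rw [← iota_res J (i+1) h, ← hx, hδ']
      · omega
    · rintro ⟨y, rfl⟩
      obtain ⟨t, e, rfl⟩ := iota_surj J i _ y
      rw [hδ']
      refine Eq.trans (LCmap_iota J (i+1) t f _) ?_
      have := hS.extClass_comp
      rw [Abelian.Ext.comp_assoc_of_third_deg_zero]
      change iota J (i+1) t S.X₂ (e.comp (hS.extClass.comp (Abelian.Ext.mk₀ S.f) _) _) = 0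
      rw [this, Abelian.Ext.comp_zero, map_zero]

theorem LC_half (f : X →ₗ[R] Y) (g : Y →ₗ[R] Z) (hf : Function.Injective f)
    (hg : Function.Surjective g) (hfg : Function.Exact f g) (i : ℕ) :
      Function.Exact (LCmap J i f) (LCmap J i g) := by
  let S : ShortComplex (ModuleCat.{u} R) := ShortComplex.mk (ModuleCat.ofHom f) (ModuleCat.ofHom g)
    (by ext x; exact hfg.apply_apply_eq_zero x)
  have hS : S.ShortExact :=
    { exact := (ShortComplex.ShortExact.moduleCat_exact_iff_function_exact _).2 hfg
      mono_f := (ModuleCat.mono_iff_injective _).2 hf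
      epi_g := (ModuleCat.epi_iff_surjective _).2 hg }
  intro z
  constructor
  · intro hz
    obtain ⟨t, e, rfl⟩ := iota_surj J i _ z
    rw [LCmap_iota] at hz
    obtain ⟨s, h, hs⟩ := iota_zero J i t _ _ hz
    rw [← Abelian.Ext.comp_assoc _ _ _ _ _ (by omega)] at hs
    · obtain ⟨x, hx⟩ := Abelian.Ext.covariant_sequence_exact₂ _ hS _ hs
      refine ⟨iota J i s (ModuleCat.of R X) x, ?_⟩
      rw [← iota_res J i h, ← hx, LCmap_iota]
    · omega
  · rintro ⟨y, rfl⟩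
    have : g ∘ₗ f = 0 := by ext x; exact hfg.apply_apply_eq_zero x
    rw [← LinearMap.comp_apply, ← LCmap_comp, this, LCmap_zero]

lemma LC_inj_zero [Module.Injective R X] (i : ℕ) : Subsingleton (LC J (i+1) X) := by
  have : CategoryTheory.Injective (ModuleCat.of R X) := Module.injective_object_of_injective_module R X
  refine subsingleton_of_forall_eq 0 fun x => ?_
  obtain ⟨t, e, rfl⟩ := iota_surj J (i+1) _ x
  rw [Abelian.Ext.eq_zero_of_injective e, map_zero]

/-- torsion submodule -/
def Gam (X : Type u) [AddCommGroup X] [Module R X] : Submodule R X where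
  carrier := { x | ∃ t, ∀ r ∈ J ^ t, r • x = 0 }
  zero_mem' := ⟨0, by simp⟩
  add_mem' := by
    rintro x y ⟨t, ht⟩ ⟨s, hs⟩
    refine ⟨max t s, fun r hr => ?_⟩
    rw [smul_add, ht r (Ideal.pow_le_pow_right (le_max_left _ _) hr),
      hs r (Ideal.pow_le_pow_right (le_max_right _ _) hr), add_zero]
  smul_mem' := by
    rintro c x ⟨t, ht⟩
    exact ⟨t, fun r hr => by rw [smul_comm, ht r hr, smul_zero]⟩

lemma mem_Gam (x : X) : x ∈ Gam J X ↔ ∃ t, ∀ r ∈ J ^ t, r • x = 0 := Iff.rfl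

theorem ev_exists (X : Type u) [AddCommGroup X] [Module R X] :
    ∃ F : LC J 0 X →ₗ[R] X, ∀ t (φ : QM J t ⟶ ModuleCat.of R X),
      F (iota J 0 t _ (Abelian.Ext.mk₀ φ)) = φ.hom (Ideal.Quotient.mk _ 1) := by
  obtain ⟨F, hF⟩ := iota_desc J 0 (ModuleCat.of R X) (ModuleCat.of R X)
    (fun t => { toFun := fun e => (Abelian.Ext.linearEquiv₀ (R := R) e).hom (Ideal.Quotient.mk _ 1)
                map_add' := by intro x y; rw [map_add]; rfl
                map_smul' := by intro r x; rw [map_smul]; rfl }) (by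
    intro t s h e
    obtain ⟨φ, rfl⟩ := (Abelian.Ext.linearEquiv₀ (R := R)).symm.surjective e
    have h1 : (Abelian.Ext.linearEquiv₀ (R := R)).symm φ = Abelian.Ext.mk₀ φ := rfl
    have h2 : (Abelian.Ext.mk₀ (QMr J h)).comp (Abelian.Ext.mk₀ φ) (zero_add 0) =
      (Abelian.Ext.linearEquiv₀ (R := R)).symm (QMr J h ≫ φ) := by
      rw [Abelian.Ext.mk₀_comp_mk₀]; rfl
    simp only [LinearMap.coe_mk, AddHom.coe_mk]
    rw [h1, h2, ← h1, LinearEquiv.apply_symm_apply, LinearEquiv.apply_symm_apply]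
    rfl)
  refine ⟨F, fun t φ => (hF t _).trans ?_⟩
  have h1 : Abelian.Ext.mk₀ φ = (Abelian.Ext.linearEquiv₀ (R := R)).symm φ  := rfl
  simp only [LinearMap.coe_mk, AddHom.coe_mk]
  rw [h1, LinearEquiv.apply_symm_apply]

/-- `H^0 → X` -/
def ev (X : Type u) [AddCommGroup X] [Module R X] : LC J 0 X →ₗ[R] X := (ev_exists J X).choose

lemma ev_iota (t : ℕ) (φ : QM J t ⟶ ModuleCat.of R X) :
    ev J X (iota J 0 t _ (Abelian.Ext.mk₀ φ)) = φ.hom (Ideal.Quotient.mk _ 1) :=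
  (ev_exists J X).choose_spec t φ

lemma LC0_rep (x : LC J 0 X) : ∃ t, ∃ φ : QM J t ⟶ ModuleCat.of R X, x = iota J 0 t _ (Abelian.Ext.mk₀ φ) := by
  obtain ⟨t, e, rfl⟩ := iota_surj J 0 _ x
  obtain ⟨φ, rfl⟩ := (Abelian.Ext.mk₀_bijective _ _).2 e
  exact ⟨t, φ, rfl⟩

lemma ev_inj : Function.Injective (ev J X) := by
  rw [injective_iff_map_eq_zero]
  intro x hx
  obtain ⟨t, φ, rfl⟩ := LC0_rep J x
  rw [ev_iota] at hx
  have : φ = 0 := by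
    ext
    exact hx
  rw [this, Abelian.Ext.mk₀_zero, map_zero]

lemma ev_range : LinearMap.range (ev J X) = Gam J X := by
  ext x
  constructor
  · rintro ⟨y, rfl⟩
    obtain ⟨t, ht⟩ := LC_torsion J 0 y
    exact ⟨t, fun r hr => by rw [← map_smul, ht r hr, map_zero]⟩
  · rintro ⟨t, ht⟩
    let φ : QM J t ⟶ ModuleCat.of R X :=
      ModuleCat.ofHom ((J ^ t).liftQ (LinearMap.toSpanSingleton R X x) (fun r hr => ht r hr))
    refine ⟨iota J 0 t _ (Abelian.Ext.mk₀ φ), ?_⟩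
    rw [ev_iota]
    change (1 : R) • x = x
    rw [one_smul]

lemma ev_nat (f : X →ₗ[R] Y) (x : LC J 0 X) : ev J Y (LCmap J 0 f x) = f (ev J X x) := by
  obtain ⟨t, φ, rfl⟩ := LC0_rep J x
  rw [LCmap_iota, Abelian.Ext.mk₀_comp_mk₀, ev_iota, ev_iota]
  rfl

end
end part3

section part4
set_option linter.unusedSectionVars false

variable {R : Type u} [CommRing R]

lemma inj_ext {A B I : Type u} [AddCommGroup A] [AddCommGroup B] [AddCommGroup I]
    [Module R A] [Module R B] [Module R I] [Module.Injective R I] (p : A →ₗ[R] B) (g : A →ₗ[R] I)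
    (h : LinearMap.ker p ≤ LinearMap.ker g) : ∃ k : B →ₗ[R] I, k ∘ₗ p = g := by
  obtain ⟨k, hk⟩ := Module.Injective.out ((LinearMap.ker p).liftQ p le_rfl)
    (LinearMap.ker_eq_bot.1 (Submodule.ker_liftQ_eq_bot _ _ _ le_rfl)) ((LinearMap.ker p).liftQ g h)
  refine ⟨k, ?_⟩
  ext x
  exact hk (Submodule.Quotient.mk x)

lemma embed_inj (X : Type u) [AddCommGroup X] [Module R X] :
    ∃ (E : Type u) (_ : AddCommGroup E) (_ : Module R E) (f : X →ₗ[R] E),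
      Function.Injective f ∧ Module.Injective R E := by
  let I : ModuleCat.{u} R := Injective.under (ModuleCat.of R X)
  let f : ModuleCat.of R X ⟶ I := Injective.ι (ModuleCat.of R X)
  have hf : Mono f := inferInstanceAs (Mono (Injective.ι (ModuleCat.of R X)))
  refine ⟨I, inferInstance, inferInstance, f.hom, (ModuleCat.mono_iff_injective f).1 hf, ?_⟩
  have : CategoryTheory.Injective (ModuleCat.of R I) :=
    Injective.injective_under (ModuleCat.of R X)
  exact Module.injective_module_of_injective_object R _

variable [IsNoetherianRing R] (b : Ideal R)

lemma Gam_fg {X Y : Type u} [AddCommGroup X] [Module R X] [Module.Finite R X]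
    [AddCommGroup Y] [Module R Y] (g : X →ₗ[R] Y) (h : ∀ x, g x ∈ Gam b Y) :
    ∃ t, ∀ r ∈ b ^ t, ∀ x : X, r • g x = 0 := by
  obtain ⟨s, hs⟩ := Module.Finite.fg_top (R := R) (M := X)
  have h1 : ∀ x : X, ∃ t, ∀ r ∈ b ^ t, r • g x = 0 := h
  choose t ht using h1
  refine ⟨s.sup t, fun r hr x => ?_⟩
  have hx : x ∈ Submodule.span R (s : Set X) := hs ▸ Submodule.mem_top
  induction hx using Submodule.span_induction with
  | mem x hx => exact ht x r (Ideal.pow_le_pow_right (Finset.le_sup hx) hr)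
  | zero => simp
  | add x y _ _ h1 h2 => rw [map_add, smul_add, h1, h2, add_zero]
  | smul c x _ h1 => rw [map_smul, smul_comm, h1, smul_zero]

lemma Gam_inj {I : Type u} [AddCommGroup I] [Module R I] [Module.Injective R I] :
    Module.Injective R (Gam b I) := by
  apply Module.Baer.injective
  intro K g
  obtain ⟨t, ht⟩ := Gam_fg b ((Gam b I).subtype ∘ₗ g) (fun x => (g x).2)
  obtain ⟨k, hk⟩ := Ideal.exists_pow_inf_eq_pow_smul b K
  have h1 := hk (t + k) (by omega)
  have h2 : ∀ x : K, (x : R) ∈ b ^ (t + k) → g x = 0 := by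
    intro x hx
    have h3 : (x : R) ∈ (b ^ (t + k) • ⊤ ⊓ K : Ideal R) := by
      refine ⟨?_, x.2⟩
      simpa using hx
    rw [h1, Nat.add_sub_cancel] at h3
    have h4 : (x : R) ∈ b ^ t • K := Submodule.smul_mono le_rfl inf_le_right h3
    have h5 : ∀ y ∈ b ^ t • K, ∃ hy : y ∈ K, ((g ⟨y, hy⟩ : Gam b I) : I) = 0 := by
      intro y hy
      refine Submodule.smul_induction_on hy ?_ ?_
      · intro r hr n hn
        refine ⟨K.smul_mem r hn, ?_⟩
        have := ht r hr ⟨n, hn⟩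
        rw [← map_smul] at this
        exact this
      · rintro x y ⟨hxK, hx⟩ ⟨hyK, hy⟩
        refine ⟨K.add_mem hxK hyK, (congrArg Subtype.val (map_add g ⟨x, hxK⟩ ⟨y, hyK⟩)).trans ?_⟩
        rw [Submodule.coe_add, hx, hy, add_zero]
    exact Subtype.ext (h5 _ h4).2
  obtain ⟨h, hh⟩ := inj_ext ((b ^ (t + k)).mkQ ∘ₗ K.subtype) ((Gam b I).subtype ∘ₗ g) (by
    intro x hx
    have : (x : R) ∈ b ^ (t + k) := by
      exact Ideal.Quotient.eq_zero_iff_mem.1 hx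
    rw [LinearMap.mem_ker, LinearMap.comp_apply, h2 x this, map_zero])
  refine ⟨(h ∘ₗ (b ^ (t + k)).mkQ).codRestrict (Gam b I) (fun c => ⟨t + k, fun r hr => ?_⟩), fun x hx => ?_⟩
  · rw [← map_smul]
    have : r • c ∈ LinearMap.ker (b ^ (t + k)).mkQ := by
      rw [Submodule.ker_mkQ]
      exact Ideal.mul_mem_right _ _ hr
    rw [LinearMap.comp_apply, LinearMap.mem_ker.1 this, map_zero]
  · apply Subtype.ext
    exact LinearMap.congr_fun hh ⟨x, hx⟩

lemma tors_embed (X : Type u) [AddCommGroup X] [Module R X] (hX : Gam b X = ⊤) :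
    ∃ (E : Type u) (_ : AddCommGroup E) (_ : Module R E) (f : X →ₗ[R] E),
      Function.Injective f ∧ Module.Injective R E ∧ Gam b E = ⊤ := by
  obtain ⟨I, _, _, f, hf, hI⟩ := embed_inj (R := R) X
  refine ⟨Gam b I, inferInstance, inferInstance, f.codRestrict (Gam b I) ?_, ?_, Gam_inj b, ?_⟩
  · intro x
    have : x ∈ Gam b X := hX ▸ Submodule.mem_top
    obtain ⟨t, ht⟩ := this
    exact ⟨t, fun r hr => by rw [← map_smul, ht r hr, map_zero]⟩
  · intro x y h
    exact hf (congrArg Subtype.val h)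
  · rw [eq_top_iff]
    rintro ⟨x, t, ht⟩ -
    exact ⟨t, fun r hr => Subtype.ext (ht r hr)⟩

lemma Gam_quot {X : Type u} [AddCommGroup X] [Module R X] (hX : Gam b X = ⊤) (U : Submodule R X) :
    Gam b (X ⧸ U) = ⊤ := by
  rw [eq_top_iff]
  intro x _
  obtain ⟨x, rfl⟩ := U.mkQ_surjective x
  have : x ∈ Gam b X := hX ▸ Submodule.mem_top
  obtain ⟨t, ht⟩ := this
  exact ⟨t, fun r hr => by rw [← map_smul, ht r hr, map_zero]⟩

lemma exact_range_mkQ {X E : Type u} [AddCommGroup X] [Module R X] [AddCommGroup E] [Module R E]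
    (f : X →ₗ[R] E) : Function.Exact f (LinearMap.range f).mkQ := by
  intro y
  simp

/-- torsion modules have no higher local cohomology -/
theorem LC_tors_zero (i : ℕ) : ∀ (X : Type u) [AddCommGroup X] [Module R X], Gam b X = ⊤ →
    Subsingleton (LC b (i+1) X) := by
  induction i with
  | zero =>
    intro X _ _ hX
    obtain ⟨E, _, _, f, hf, hE, hG⟩ := tors_embed b X hX
    obtain ⟨δ, h1, h2⟩ := LC_les b f (LinearMap.range f).mkQ hf (Submodule.mkQ_surjective _) (exact_range_mkQ f) 0
    have := LC_inj_zero b (X := E) 0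
    refine subsingleton_of_forall_eq 0 fun x => ?_
    obtain ⟨y, rfl⟩ := (h2 x).1 (Subsingleton.elim _ _)
    apply (h1 y).2
    obtain ⟨e, he⟩ := Submodule.mkQ_surjective _ (ev b _ y)
    have h3 : e ∈ LinearMap.range (ev b E) := by rw [ev_range, hG]; trivial
    obtain ⟨z, rfl⟩ := h3
    refine ⟨z, ev_inj b ?_⟩
    rw [ev_nat, he]
  | succ i ih =>
    intro X _ _ hX
    obtain ⟨E, _, _, f, hf, hE, hG⟩ := tors_embed b X hX
    obtain ⟨δ, h1, h2⟩ := LC_les b f (LinearMap.range f).mkQ hf (Submodule.mkQ_surjective _) (exact_range_mkQ f) (i+1)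
    have := LC_inj_zero b (X := E) (i+1)
    have := ih _ (Gam_quot b hG (LinearMap.range f))
    refine subsingleton_of_forall_eq 0 fun x => ?_
    obtain ⟨y, rfl⟩ := (h2 x).1 (Subsingleton.elim _ _)
    rw [Subsingleton.elim y 0, map_zero]

/-- `H^0` is the torsion submodule -/
def LC0equiv (X : Type u) [AddCommGroup X] [Module R X] : LC b 0 X ≃ₗ[R] Gam b X :=
  (LinearEquiv.ofInjective (ev b X) (ev_inj b)).trans (LinearEquiv.ofEq _ _ (ev_range b))

lemma LC0equiv_coe {X : Type u} [AddCommGroup X] [Module R X] (x : LC b 0 X) :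
    ((LC0equiv b X x : Gam b X) : X) = ev b X x := rfl

/-- comparison of `H^0`s -/
def LC0cmp (a c : Ideal R) (X : Type u) [AddCommGroup X] [Module R X] (h : Gam a X = Gam c X) :
    LC a 0 X ≃ₗ[R] LC c 0 X :=
  ((LC0equiv a X).trans (LinearEquiv.ofEq _ _ h)).trans (LC0equiv c X).symm

lemma LC0cmp_ev (a c : Ideal R) (X : Type u) [AddCommGroup X] [Module R X] (h : Gam a X = Gam c X)
    (x : LC a 0 X) : ev c X (LC0cmp a c X h x) = ev a X x := by
  rw [← LC0equiv_coe]
  simp [LC0cmp, LC0equiv_coe]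

/-- comparison theorem -/
theorem LC_cmp (a c : Ideal R) (hac : ∀ (X : Type u) [AddCommGroup X] [Module R X], Gam b X = ⊤ →
    Gam a X = Gam c X) (i : ℕ) : ∀ (X : Type u) [AddCommGroup X] [Module R X], Gam b X = ⊤ →
    Nonempty (LC a i X ≃ₗ[R] LC c i X) := by
  induction i with
  | zero => exact fun X _ _ hX => ⟨LC0cmp a c X (hac X hX)⟩
  | succ i ih =>
    intro X _ _ hX
    obtain ⟨E, _, _, f, hf, hE, hG⟩ := tors_embed b X hX
    obtain ⟨δ, h1, h2⟩ := LC_les a f (LinearMap.range f).mkQ hf (Submodule.mkQ_surjective _) (exact_range_mkQ f) i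
    obtain ⟨δ', h1', h2'⟩ := LC_les c f (LinearMap.range f).mkQ hf (Submodule.mkQ_surjective _) (exact_range_mkQ f) i
    have := LC_inj_zero a (X := E) i
    have := LC_inj_zero c (X := E) i
    have hs : Function.Surjective δ := fun x => (h2 x).1 (Subsingleton.elim _ _)
    have hs' : Function.Surjective δ' := fun x => (h2' x).1 (Subsingleton.elim _ _)
    have hQ := Gam_quot b hG (LinearMap.range f)
    have key : ∃ e : LC a i (E ⧸ LinearMap.range f) ≃ₗ[R] LC c i (E ⧸ LinearMap.range f),
        Submodule.map e.toLinearMap (LinearMap.ker δ) = LinearMap.ker δ' := by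
      rw [h1.linearMap_ker_eq, h1'.linearMap_ker_eq]
      cases i with
      | zero =>
        refine ⟨LC0cmp a c _ (hac _ hQ), ?_⟩
        apply le_antisymm
        · rintro _ ⟨_, ⟨y, rfl⟩, rfl⟩
          refine ⟨LC0cmp a c _ (hac _ hG) y, ev_inj c ?_⟩
          rw [ev_nat, LC0cmp_ev]
          exact (ev_nat a _ y).symm.trans (LC0cmp_ev a c _ _ _).symm
        · rintro _ ⟨y, rfl⟩
          obtain ⟨y, rfl⟩ := (LC0cmp a c _ (hac _ hG)).surjective y
          refine ⟨_, ⟨y, rfl⟩, ev_inj c ?_⟩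
          rw [ev_nat, LC0cmp_ev]
          exact (LC0cmp_ev a c _ _ _).trans (ev_nat a _ y)
      | succ i =>
        obtain ⟨e⟩ := ih _ hQ
        refine ⟨e, ?_⟩
        have := LC_inj_zero a (X := E) i
        have := LC_inj_zero c (X := E) i
        have z1 : LinearMap.range (LCmap a (i+1) (LinearMap.range f).mkQ) = ⊥ := by
          rw [LinearMap.range_eq_bot]; ext x; rw [Subsingleton.elim x 0, map_zero, map_zero]
        have z2 : LinearMap.range (LCmap c (i+1) (LinearMap.range f).mkQ) = ⊥ := by
          rw [LinearMap.range_eq_bot]; ext x; rw [Subsingleton.elim x 0, map_zero, map_zero]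
        rw [z1, z2, Submodule.map_bot]
    obtain ⟨e, he⟩ := key
    exact ⟨(δ.quotKerEquivOfSurjective hs).symm.trans ((Submodule.Quotient.equiv _ _ e he).trans
      (δ'.quotKerEquivOfSurjective hs'))⟩

lemma Gam_sup (a : Ideal R) (X : Type u) [AddCommGroup X] [Module R X] (h : Gam b X = ⊤) :
    Gam a X = Gam (a ⊔ b) X := by
  ext x
  constructor
  · rintro ⟨t, ht⟩
    have : x ∈ Gam b X := h ▸ Submodule.mem_top
    obtain ⟨s, hs⟩ := this
    refine ⟨t + s, fun r hr => ?_⟩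
    have := Ideal.sup_pow_add_le_pow_sup_pow hr
    obtain ⟨y, hy, z, hz, rfl⟩ := Submodule.mem_sup.1 this
    rw [add_smul, ht y hy, hs z hz, add_zero]
  · rintro ⟨t, ht⟩
    exact ⟨t, fun r hr => ht r (Ideal.pow_right_mono le_sup_left t hr)⟩

theorem LC_sup (a : Ideal R) (i : ℕ) (X : Type u) [AddCommGroup X] [Module R X]
    (h : ∀ r ∈ b, ∀ x : X, r • x = 0) :
    Nonempty (LC a i X ≃ₗ[R] LC (a ⊔ b) i X) :=
  LC_cmp b a (a ⊔ b) (fun X _ _ h => Gam_sup b a X h) i X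
    (eq_top_iff.2 fun x _ => ⟨1, fun r hr => h r (by simpa using hr) x⟩)

end part4

section part5
set_option linter.unusedSectionVars false

variable {R : Type u} [CommRing R] [IsNoetherianRing R] (J : Ideal R)

theorem filt (S : ∀ (X : Type u) [AddCommGroup X] [Module R X], Prop)
    (hsub : ∀ (X : Type u) [AddCommGroup X] [Module R X], Subsingleton X → S X)
    (heq : ∀ (X Y : Type u) [AddCommGroup X] [Module R X] [AddCommGroup Y] [Module R Y],
      (X ≃ₗ[R] Y) → S X → S Y)
    (hses : ∀ (X Y Z : Type u) [AddCommGroup X] [Module R X] [AddCommGroup Y] [Module R Y]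
      [AddCommGroup Z] [Module R Z] (f : X →ₗ[R] Y) (g : Y →ₗ[R] Z), Function.Injective f →
      Function.Surjective g → Function.Exact f g → S X → S Z → S Y)
    (M : Type u) [AddCommGroup M] [Module R M] [Module.Finite R M]
    (h : ∀ q : Ideal R, q.IsPrime → Module.annihilator R M ≤ q → S (R ⧸ q)) : S M := by
  revert h
  refine IsNoetherianRing.induction_on_isQuotientEquivQuotientPrime R (M := M) inferInstance
    (motive := fun N _ _ _ => (∀ q : Ideal R, q.IsPrime → Module.annihilator R N ≤ q → S (R ⧸ q)) → S N) ?_ ?_ ?_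
  · intro N _ _ _ h _
    exact hsub N h
  · intro N _ _ _ p e h
    refine heq _ _ e.symm (h p.asIdeal p.isPrime ?_)
    rw [e.annihilator_eq, Ideal.annihilator_quotient]
  · intro N₁ _ _ _ N₂ _ _ _ N₃ _ _ _ f g hf hg hfg h1 h3 h
    refine hses _ _ _ f g hf hg hfg (h1 fun q hq hle => ?_) (h3 fun q hq hle => ?_)
    · exact h q hq ((LinearMap.annihilator_le_of_injective f hf).trans hle)
    · exact h q hq ((LinearMap.annihilator_le_of_surjective g hg).trans hle)

lemma LC_sub_ses {X Y Z : Type u} [AddCommGroup X] [Module R X] [AddCommGroup Y] [Module R Y]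
      [AddCommGroup Z] [Module R Z] (f : X →ₗ[R] Y) (g : Y →ₗ[R] Z) (hf : Function.Injective f)
      (hg : Function.Surjective g) (hfg : Function.Exact f g) (i : ℕ)
      (h1 : Subsingleton (LC J i X)) (h3 : Subsingleton (LC J i Z)) : Subsingleton (LC J i Y) := by
  refine subsingleton_of_forall_eq 0 fun y => ?_
  obtain ⟨x, rfl⟩ := (LC_half J f g hf hg hfg i y).1 (Subsingleton.elim _ _)
  rw [Subsingleton.elim x 0, map_zero]

lemma LC_sub_of_sub (X : Type u) [AddCommGroup X] [Module R X] (i : ℕ) (h : Subsingleton X) :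
    Subsingleton (LC J i X) := by
  refine subsingleton_of_forall_eq 0 fun y => ?_
  have : (LinearMap.id : X →ₗ[R] X) = 0 := Subsingleton.elim _ _
  have h2 := LCmap_id J (X := X) i
  rw [← LinearMap.id_apply (R := R) y, ← h2, this, LCmap_zero]

theorem LC_filt (i : ℕ) (M : Type u) [AddCommGroup M] [Module R M] [Module.Finite R M]
    (h : ∀ q : Ideal R, q.IsPrime → Module.annihilator R M ≤ q → Subsingleton (LC J i (R ⧸ q))) :
    Subsingleton (LC J i M) :=
  filt (fun X _ _ => Subsingleton (LC J i X)) (fun X _ _ h => LC_sub_of_sub J X i h)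
    (fun X Y _ _ _ _ e h => (LCequiv J i e).symm.toEquiv.subsingleton)
    (fun X Y Z _ _ _ _ _ _ f g hf hg hfg h1 h3 => LC_sub_ses J f g hf hg hfg i h1 h3) M h

lemma dim_lt_of_lt (P q : Ideal R) [P.IsPrime] [q.IsPrime] (h : P < q) :
    ringKrullDim (R ⧸ q) + 1 ≤ ringKrullDim (R ⧸ P) := by
  obtain ⟨x, hxq, hxP⟩ := SetLike.exists_of_lt h
  have hx : Ideal.Quotient.mk P x ∈ nonZeroDivisors (R ⧸ P) := by
    rw [mem_nonZeroDivisors_iff_ne_zero]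
    rwa [Ne, Ideal.Quotient.eq_zero_iff_mem]
  refine le_trans ?_ (ringKrullDim_quotient_succ_le_of_nonZeroDivisor hx)
  gcongr
  let φ : (R ⧸ P) →+* R ⧸ q := Ideal.Quotient.factor h.le
  refine ringKrullDim_le_of_surjective (Ideal.Quotient.lift (Ideal.span {Ideal.Quotient.mk P x}) φ ?_) ?_
  · intro y hy
    have : Ideal.span {Ideal.Quotient.mk P x} ≤ RingHom.ker φ := by
      rw [Ideal.span_singleton_le_iff_mem, RingHom.mem_ker]
      change Ideal.Quotient.mk q x = 0
      rwa [Ideal.Quotient.eq_zero_iff_mem]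
    exact this hy
  · apply Ideal.Quotient.lift_surjective_of_surjective
    exact Ideal.Quotient.factor_surjective h.le

lemma dim_step {P q : Ideal R} [P.IsPrime] [q.IsPrime] (h : P < q) {i : ℕ}
    (hi : ringKrullDim (R ⧸ P) < (i + 1 : ℕ)) : ringKrullDim (R ⧸ q) < i := by
  have h1 := (dim_lt_of_lt P q h).trans_lt hi
  by_contra h2
  rw [not_lt] at h2
  refine absurd h1 (not_lt.2 ?_)
  push_cast
  gcongr

/-- `(R/P)/x` -/
abbrev PX (P : Ideal R) (x : R) : Type u :=
  (R ⧸ P) ⧸ LinearMap.range (x • (LinearMap.id : (R ⧸ P) →ₗ[R] (R ⧸ P)))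

lemma PX_ann (P : Ideal R) (x : R) : P ⊔ Ideal.span {x} ≤ Module.annihilator R (PX P x) := by
  apply sup_le
  · intro r hr
    rw [Module.mem_annihilator]
    intro z
    obtain ⟨z, rfl⟩ := Submodule.mkQ_surjective _ z
    obtain ⟨z, rfl⟩ := Submodule.mkQ_surjective _ z
    rw [← map_smul, ← map_smul]
    have : P.mkQ (r • z) = 0 := Ideal.Quotient.eq_zero_iff_mem.2 (P.mul_mem_right _ hr)
    rw [this, map_zero]
  · rw [Ideal.span_singleton_le_iff_mem, Module.mem_annihilator]
    intro z
    obtain ⟨z, rfl⟩ := Submodule.mkQ_surjective _ z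
    rw [← map_smul]
    exact (Submodule.Quotient.mk_eq_zero _).2 ⟨z, rfl⟩

lemma PX_prime {P q : Ideal R} {x : R} (hx : x ∉ P) (h : Module.annihilator R (PX P x) ≤ q) :
    P < q ∧ x ∈ q := by
  have h1 := (PX_ann P x).trans h
  have h2 : x ∈ q := h1 (Ideal.mem_sup_right (Ideal.mem_span_singleton_self x))
  exact ⟨lt_of_le_of_ne (le_sup_left.trans h1) (fun e => hx (e ▸ h2)), h2⟩

lemma PX_inj {P : Ideal R} [P.IsPrime] {x : R} (hx : x ∉ P) :
    Function.Injective (x • (LinearMap.id : (R ⧸ P) →ₗ[R] (R ⧸ P))) := by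
  rw [injective_iff_map_eq_zero]
  intro z hz
  obtain ⟨z, rfl⟩ := Ideal.Quotient.mk_surjective z
  have : x * z ∈ P := by
    rw [← Ideal.Quotient.eq_zero_iff_mem]; exact hz
  rw [Ideal.Quotient.eq_zero_iff_mem]
  exact (Ideal.IsPrime.mem_or_mem inferInstance this).resolve_left hx

lemma PX_delta {P : Ideal R} [P.IsPrime] {x : R} (hx : x ∉ P) (i : ℕ) :
    ∃ δ : LC J i (PX P x) →ₗ[R] LC J (i+1) (R ⧸ P), ∀ y : LC J (i+1) (R ⧸ P), x • y = 0 ↔ ∃ z, δ z = y := by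
  obtain ⟨δ, -, h⟩ := LC_les J (x • (LinearMap.id : (R ⧸ P) →ₗ[R] (R ⧸ P))) (Submodule.mkQ _) (PX_inj hx)
    (Submodule.mkQ_surjective _) (exact_range_mkQ _) i
  refine ⟨δ, fun y => ?_⟩
  have := h y
  rw [LCmap_smul] at this
  exact this

lemma PX_surj {P : Ideal R} [P.IsPrime] {x : R} (hx : x ∉ P) (i : ℕ) (h : Subsingleton (LC J i (PX P x)))
    (y : LC J i (R ⧸ P)) : ∃ z, x • z = y := by
  have h := LC_half J (x • (LinearMap.id : (R ⧸ P) →ₗ[R] (R ⧸ P))) (Submodule.mkQ _) (PX_inj hx)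
    (Submodule.mkQ_surjective _) (exact_range_mkQ _) i
  obtain ⟨z, hz⟩ := (h y).1 (Subsingleton.elim _ _)
  exact ⟨z, by rw [← LCmap_smul, hz]⟩

lemma LC_le_zero {P : Ideal R} (h : J ≤ P) (i : ℕ) : Subsingleton (LC J (i+1) (R ⧸ P)) := by
  apply LC_tors_zero
  rw [eq_top_iff]
  intro z _
  refine ⟨1, fun r hr => ?_⟩
  rw [pow_one] at hr
  obtain ⟨z, rfl⟩ := Ideal.Quotient.mk_surjective z
  exact Ideal.Quotient.eq_zero_iff_mem.2 (P.mul_mem_right _ (h hr))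

lemma LC_pow_tors {X : Type u} [AddCommGroup X] [Module R X] {i : ℕ} (y : LC J i X) {x : R} (hx : x ∈ J) :
    ∃ t, x ^ t • y = 0 := by
  obtain ⟨t, ht⟩ := LC_torsion J i y
  exact ⟨t, ht _ (Ideal.pow_mem_pow hx t)⟩

theorem GVp (i : ℕ) : ∀ (P : Ideal R), P.IsPrime → ringKrullDim (R ⧸ P) < i → Subsingleton (LC J i (R ⧸ P)) := by
  induction i with
  | zero =>
    intro P hP h
    exact absurd h (not_lt.2 (by simpa using ringKrullDim_nonneg_of_nontrivial))
  | succ i ih =>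
    intro P hP h
    by_cases hJ : J ≤ P
    · exact LC_le_zero J hJ i
    obtain ⟨x, hxJ, hxP⟩ := Set.not_subset.1 hJ
    obtain ⟨δ, hδ⟩ := PX_delta J hxP i
    have h0 : Subsingleton (LC J i (PX P x)) := LC_filt J i _ fun q hq hle => by
      exact ih q hq (dim_step (PX_prime hxP hle).1 h)
    have hinj : ∀ y : LC J (i+1) (R ⧸ P), x • y = 0 → y = 0 := by
      intro y hy
      obtain ⟨z, rfl⟩ := (hδ y).1 hy
      rw [Subsingleton.elim z 0, map_zero]
    refine subsingleton_of_forall_eq 0 fun y => ?_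
    obtain ⟨t, ht⟩ := LC_pow_tors J y hxJ
    induction t with
    | zero => simpa using ht
    | succ t iht =>
      apply iht
      apply hinj
      rw [smul_smul, ← pow_succ']
      exact ht

/-- Grothendieck vanishing -/
theorem GV (i : ℕ) (M : Type u) [AddCommGroup M] [Module R M] [Module.Finite R M]
    (h : ∀ q : Ideal R, q.IsPrime → Module.annihilator R M ≤ q → ringKrullDim (R ⧸ q) < i) :
    Subsingleton (LC J i M) :=
  LC_filt J i M fun q hq hle => GVp J i q hq (h q hq hle)

end part5

section part6
set_option linter.unusedSectionVars false

variable {R : Type u} [CommRing R]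

lemma inj_hull (K : Type u) [AddCommGroup K] [Module R K] :
    ∃ (E : Type u) (_ : AddCommGroup E) (_ : Module R E) (f : K →ₗ[R] E),
      Function.Injective f ∧ Module.Injective R E ∧
      ∀ x : E, x ≠ 0 → ∃ r : R, r • x ≠ 0 ∧ r • x ∈ LinearMap.range f := by
  obtain ⟨I, _, _, j, hj, hI⟩ := embed_inj (R := R) K
  let S : Set (Submodule R I) := {F | LinearMap.range j ≤ F ∧
    ∀ x ∈ F, x ≠ 0 → ∃ r : R, r • x ≠ 0 ∧ r • x ∈ LinearMap.range j}
  have hS : LinearMap.range j ∈ S :=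
    ⟨le_rfl, fun x hx h0 => ⟨1, by simpa using h0, by simpa using hx⟩⟩
  obtain ⟨F, hF1, hF⟩ := zorn_le_nonempty₀ S (by
    intro c hcS hc y hy
    refine ⟨sSup c, ⟨(hcS hy).1.trans (le_sSup hy), ?_⟩, fun z hz => le_sSup hz⟩
    intro x hx h0
    obtain ⟨z, hz, hxz⟩ := (Submodule.mem_sSup_of_directed ⟨y, hy⟩ hc.directedOn).1 hx
    exact (hcS hz).2 x hxz h0) _ hS
  obtain ⟨C, hC1, hC⟩ := zorn_le_nonempty₀ {C : Submodule R I | ∀ x ∈ C, x ∈ F → x = 0} (by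
    intro c hcS hc y hy
    refine ⟨sSup c, ?_, fun z hz => le_sSup hz⟩
    intro x hx h0
    obtain ⟨z, hz, hxz⟩ := (Submodule.mem_sSup_of_directed ⟨y, hy⟩ hc.directedOn).1 hx
    exact (hcS hz) x hxz h0) ⊥ (by intro x hx _; simpa using hx)
  have hess : ∀ y, y ∉ C → ∃ r : R, ∃ c ∈ C, c + r • y ∈ F ∧ c + r • y ≠ 0 := by
    intro y hy
    by_contra hcon
    push Not at hcon
    have h1 : (C ⊔ Submodule.span R {y}) ≤ C := by
      refine hC.2 ?_ le_sup_left
      intro x hx hxF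
      obtain ⟨c, hc, z, hz, rfl⟩ := Submodule.mem_sup.1 hx
      obtain ⟨r, rfl⟩ := Submodule.mem_span_singleton.1 hz
      exact hcon r c hc hxF
    exact hy (h1 (le_sup_right (a := C) (Submodule.mem_span_singleton_self y)))
  obtain ⟨ψ, hψ⟩ := inj_ext (C.mkQ ∘ₗ F.subtype) F.subtype (by
    intro x hx
    have hx' : (x : I) ∈ C := by simpa using hx
    have := hC.1 x hx' x.2
    simpa using this)
  have hψ1 : ∀ x ∈ F, ψ (C.mkQ x) = x := fun x hx => LinearMap.congr_fun hψ ⟨x, hx⟩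
  have hψ2 : ∀ x ∈ C, ψ (C.mkQ x) = 0 := fun x hx => by
    rw [show C.mkQ x = 0 by simpa using hx, map_zero]
  have hr : LinearMap.range (ψ ∘ₗ C.mkQ) ≤ F := by
    refine hF.2 ⟨?_, ?_⟩ ?_
    · intro x hx
      exact ⟨x, hψ1 x (hF.1.1 hx)⟩
    · rintro _ ⟨y, rfl⟩ h0
      have hy : y ∉ C := fun h => h0 (hψ2 y h)
      obtain ⟨r, c, hc, h3, h4⟩ := hess y hy
      have h5 : r • ψ (C.mkQ y) = c + r • y := by
        have := hψ1 _ h3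
        rw [map_add, map_add, hψ2 c hc, zero_add, map_smul, map_smul] at this
        exact this
      obtain ⟨s, hs1, hs2⟩ := hF.1.2 _ h3 h4
      refine ⟨s * r, ?_, ?_⟩ <;> rw [mul_smul, LinearMap.comp_apply, h5] <;> assumption
    · intro x hx
      exact ⟨x, hψ1 x hx⟩
  let p : I →ₗ[R] F := (ψ ∘ₗ C.mkQ).codRestrict F (fun x => hr ⟨x, rfl⟩)
  have hp : ∀ x : F, p x = x := fun x => Subtype.ext (hψ1 x x.2)
  refine ⟨F, inferInstance, inferInstance, j.codRestrict F (fun x => hF.1.1 ⟨x, rfl⟩), ?_, ⟨?_⟩, ?_⟩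
  · intro x y h
    exact hj (congrArg Subtype.val h)
  · intro X Y _ _ _ _ f hf g
    obtain ⟨k, hk⟩ := hI.out f hf (F.subtype ∘ₗ g)
    refine ⟨p ∘ₗ k, fun x => ?_⟩
    rw [LinearMap.comp_apply, hk x]
    exact hp _
  · intro x hx
    obtain ⟨r, h3, ⟨z, hz⟩⟩ := hF.1.2 x x.2 (by simpa using hx)
    exact ⟨r, fun h => h3 (congrArg Subtype.val h), z, Subtype.ext hz⟩

variable [IsNoetherianRing R] [IsLocalRing R]

lemma hull_k : ∃ (E : Type u) (_ : AddCommGroup E) (_ : Module R E)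
      (f : (R ⧸ IsLocalRing.maximalIdeal R) →ₗ[R] E),
      Function.Injective f ∧ Module.Injective R E ∧
      Module.Finite R ((R ⧸ IsLocalRing.maximalIdeal R) →ₗ[R] E) := by
  obtain ⟨E, _, _, f, hf, hE, hess⟩ := inj_hull (R := R) (R ⧸ IsLocalRing.maximalIdeal R)
  refine ⟨E, inferInstance, inferInstance, f, hf, hE, ?_⟩
  have key : ∀ φ : (R ⧸ IsLocalRing.maximalIdeal R) →ₗ[R] E, φ 1 ∈ LinearMap.range f := by
    intro φ
    by_cases h0 : φ 1 = 0
    · rw [h0]; exact zero_mem _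
    · obtain ⟨r, h1, h2⟩ := hess _ h0
      have hr : IsUnit r := by
        by_contra hr
        apply h1
        rw [← map_smul]
        have : r • (1 : R ⧸ IsLocalRing.maximalIdeal R) = 0 := by
          rw [Algebra.smul_def, mul_one]
          exact Ideal.Quotient.eq_zero_iff_mem.2 hr
        rw [this, map_zero]
      obtain ⟨u, rfl⟩ := hr
      have := (LinearMap.range f).smul_mem (↑u⁻¹ : R) h2
      rwa [smul_smul, Units.inv_mul, one_smul] at this
  let e : ((R ⧸ IsLocalRing.maximalIdeal R) →ₗ[R] E) →ₗ[R] LinearMap.range f :=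
    (LinearMap.applyₗ (1 : R ⧸ IsLocalRing.maximalIdeal R)).codRestrict _ key
  refine Module.Finite.of_injective e ?_
  intro φ ψ h
  have h1 : φ 1 = ψ 1 := congrArg Subtype.val h
  ext
  exact h1

/-- Faithfulness of `Hom(-,E)`. -/
lemma hom_faithful (E : Type u) [AddCommGroup E] [Module R E] [Module.Injective R E]
    (f : (R ⧸ IsLocalRing.maximalIdeal R) →ₗ[R] E) (hf : Function.Injective f)
    (Q : Type u) [AddCommGroup Q] [Module R Q] (h : ∀ φ : Q →ₗ[R] E, φ = 0) : Subsingleton Q := by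
  refine subsingleton_of_forall_eq 0 fun y => ?_
  by_contra hy
  obtain ⟨φ, hφ⟩ := inj_ext (LinearMap.toSpanSingleton R Q y)
    (f ∘ₗ (IsLocalRing.maximalIdeal R).mkQ) (by
      intro r hr
      have hr' : r • y = 0 := by simpa using hr
      have : r ∈ IsLocalRing.maximalIdeal R := by
        intro hu
        obtain ⟨u, rfl⟩ := hu
        apply hy
        have := congrArg (fun z => (↑u⁻¹ : R) • z) hr'
        simpa [smul_smul] using this
      rw [LinearMap.mem_ker, LinearMap.comp_apply, show (IsLocalRing.maximalIdeal R).mkQ r = 0 from (Submodule.Quotient.mk_eq_zero _).2 this, map_zero])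
  have h1 := LinearMap.congr_fun hφ 1
  rw [h φ] at h1
  have h2 : f 1 = 0 := by
    have : f ((IsLocalRing.maximalIdeal R).mkQ 1) = 0 := by simpa using h1.symm
    exact this
  rw [← map_zero f] at h2
  have h3 : (1 : R ⧸ IsLocalRing.maximalIdeal R) = 0 := hf h2
  exact one_ne_zero h3

end part6

section part7
set_option linter.unusedSectionVars false

variable {R : Type u} [CommRing R]

lemma exists_series (m : Ideal R) [IsAdicComplete m R] {x : R} (hx : x ∈ m) :
    ∃ S : (ℕ → R) → R, ∀ c, S c = c 0 + x * S (fun t => c (t+1)) := by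
  let f : (ℕ → R) → ℕ → R := fun c T => ∑ t ∈ Finset.range T, x ^ t * c t
  have hf : ∀ c, ∃ L, ∀ T, f c T - L ∈ m ^ T := by
    intro c
    have := IsPrecomplete.prec' (I := m) (f c) (by
      intro k l hkl
      rw [SModEq.comm, SModEq.sub_mem, smul_eq_mul, Ideal.mul_top]
      change ∑ t ∈ Finset.range l, x ^ t * c t - ∑ t ∈ Finset.range k, x ^ t * c t ∈ _
      rw [← Finset.sum_range_add_sum_Ico _ hkl, add_sub_cancel_left]
      refine Ideal.sum_mem _ fun t ht => ?_
      rw [Finset.mem_Ico] at ht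
      exact Ideal.mul_mem_right _ _ (Ideal.pow_le_pow_right ht.1 (Ideal.pow_mem_pow hx t)))
    obtain ⟨L, hL⟩ := this
    refine ⟨L, fun T => ?_⟩
    have := hL T
    rwa [SModEq.sub_mem, smul_eq_mul, Ideal.mul_top] at this
  choose S hS using hf
  refine ⟨S, fun c => ?_⟩
  rw [← sub_eq_zero]
  refine IsHausdorff.haus' (I := m) _ fun T => ?_
  rw [SModEq.sub_mem, smul_eq_mul, Ideal.mul_top, sub_zero]
  have h1 := Ideal.pow_le_pow_right (Nat.le_succ T) (hS c (T+1))
  have h2 := Ideal.mul_mem_left _ x (hS (fun t => c (t+1)) T)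
  have h3 : f c (T+1) = c 0 + x * f (fun t => c (t+1)) T := by
    simp only [f]
    rw [Finset.sum_range_succ', Finset.mul_sum, add_comm]
    simp only [pow_zero, one_mul]
    congr 1
    refine Finset.sum_congr rfl fun t _ => ?_
    ring
  have h4 := (m ^ T).sub_mem h2 h1
  rw [h3] at h4
  convert h4 using 1
  ring

lemma complete_fg (m : Ideal R) [IsAdicComplete m R] {x : R} (hx : x ∈ m)
    (D : Type u) [AddCommGroup D] [Module R D] (k : ℕ) (d : Fin k → D)
    (hspan : ∀ y : D, ∃ c : Fin k → R, ∃ z, y = ∑ j, c j • d j + x • z)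
    (hsep : ∀ y : D, (∀ t : ℕ, ∃ z, y = x ^ t • z) → y = 0) : Module.Finite R D := by
  obtain ⟨S, hS⟩ := exists_series m hx
  classical
  choose c z hcz using hspan
  refine ⟨⟨Finset.univ.image d, ?_⟩⟩
  rw [eq_top_iff]
  intro y _
  let Y : ℕ → D := fun t => z^[t] y
  have hY : ∀ t, Y t = ∑ j, c (Y t) j • d j + x • Y (t+1) := by
    intro t
    have : Y (t+1) = z (Y t) := Function.iterate_succ_apply' z t y
    rw [this]
    exact hcz _
  let Z : ℕ → D := fun t => Y t - ∑ j, S (fun s => c (Y (t + s)) j) • d j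
  have hZ : ∀ t, Z t = x • Z (t+1) := by
    intro t
    simp only [Z]
    have : ∀ j, S (fun s => c (Y (t + s)) j) = c (Y t) j + x * S (fun s => c (Y (t + 1 + s)) j) := by
      intro j
      rw [hS]
      simp only [add_zero]
      congr 3
      funext s
      rw [add_assoc, add_comm 1 s]
    have hYt := hY t
    simp_rw [this, add_smul, Finset.sum_add_distrib, mul_smul]
    rw [smul_sub, Finset.smul_sum, sub_eq_iff_eq_add, ← sub_eq_zero]
    rw [← sub_eq_zero] at hYt
    rw [← hYt]
    abel
  have hZ' : ∀ t, Z 0 = x ^ t • Z t := by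
    intro t
    induction t with
    | zero => simp
    | succ t ih => rw [ih, hZ t, smul_smul, ← pow_succ]
  have h0 := hsep _ fun t => ⟨_, hZ' t⟩
  simp only [Z] at h0
  rw [sub_eq_zero] at h0
  change y = _ at h0
  rw [h0]
  refine Submodule.sum_mem _ fun j _ => Submodule.smul_mem _ _ (Submodule.subset_span ?_)
  simp

variable [IsNoetherianRing R] (a : Ideal R) (E : Type u) [AddCommGroup E] [Module R E] [Module.Injective R E]

/-- Exactness of the dual. -/
lemma dual_fg_ses {A B C : Type u} [AddCommGroup A] [Module R A] [AddCommGroup B] [Module R B]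
    [AddCommGroup C] [Module R C] (f : A →ₗ[R] B) (g : B →ₗ[R] C) (h : Function.Exact f g)
    (hA : Module.Finite R (A →ₗ[R] E)) (hC : Module.Finite R (C →ₗ[R] E)) :
    Module.Finite R (B →ₗ[R] E) := by
  have hA' : IsNoetherian R (A →ₗ[R] E) := isNoetherian_of_isNoetherianRing_of_finite R _
  have hC' : IsNoetherian R (C →ₗ[R] E) := isNoetherian_of_isNoetherianRing_of_finite R _
  have : IsNoetherian R (B →ₗ[R] E) := by
    refine isNoetherian_of_range_eq_ker (LinearMap.lcomp R E g) (LinearMap.lcomp R E f) ?_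
    apply le_antisymm
    · rintro _ ⟨φ, rfl⟩
      rw [LinearMap.mem_ker]
      ext z
      change φ (g (f z)) = 0
      rw [h.apply_apply_eq_zero, map_zero]
    · intro φ hφ
      obtain ⟨ψ, hψ⟩ := inj_ext g φ (by
        intro z hz
        obtain ⟨w, rfl⟩ := (h z).1 hz
        exact LinearMap.congr_fun hφ w)
      exact ⟨ψ, hψ⟩
  infer_instance

lemma dual_fg_filt (i : ℕ) (M : Type u) [AddCommGroup M] [Module R M] [Module.Finite R M]
    (h : ∀ q : Ideal R, q.IsPrime → Module.annihilator R M ≤ q → Module.Finite R (LC a i (R ⧸ q) →ₗ[R] E)) :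
    Module.Finite R (LC a i M →ₗ[R] E) := by
  refine filt (R := R) (fun X _ _ => Module.Finite R (LC a i X →ₗ[R] E)) ?_ ?_ ?_ M h
  · intro X _ _ hX
    have := LC_sub_of_sub a X i hX
    infer_instance
  · intro X Y _ _ _ _ e hX
    exact Module.Finite.equiv ((LCequiv a i e).congrLeft E R)
  · intro X Y Z _ _ _ _ _ _ f g hf hg hfg h1 h3
    exact dual_fg_ses E _ _ (LC_half a f g hf hg hfg i) h1 h3

variable [IsLocalRing R]

lemma eq_max_of_dim {P : Ideal R} [P.IsPrime] (h : ringKrullDim (R ⧸ P) < (1 : ℕ)) :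
    P = IsLocalRing.maximalIdeal R := by
  by_contra hne
  have hlt : P < IsLocalRing.maximalIdeal R := lt_of_le_of_ne
    (IsLocalRing.le_maximalIdeal (Ideal.IsPrime.ne_top inferInstance)) hne
  have := dim_step (i := 0) hlt (by simpa using h)
  exact absurd this (not_lt.2 (by simpa using ringKrullDim_nonneg_of_nontrivial))

variable [IsAdicComplete (IsLocalRing.maximalIdeal R) R]

lemma dual_fg (ha : a ≠ ⊤)
    (hE : Module.Finite R ((R ⧸ IsLocalRing.maximalIdeal R) →ₗ[R] E)) (n : ℕ) :
    ∀ P : Ideal R, P.IsPrime → ringKrullDim (R ⧸ P) < (n + 1 : ℕ) →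
      Module.Finite R (LC a n (R ⧸ P) →ₗ[R] E) := by
  induction n with
  | zero =>
    intro P hP h
    obtain rfl := eq_max_of_dim (by simpa using h)
    have ham := IsLocalRing.le_maximalIdeal ha
    have htop : Gam a (R ⧸ IsLocalRing.maximalIdeal R) = ⊤ := by
      rw [eq_top_iff]
      intro z _
      refine ⟨1, fun r hr => ?_⟩
      rw [pow_one] at hr
      obtain ⟨z, rfl⟩ := Ideal.Quotient.mk_surjective z
      exact Ideal.Quotient.eq_zero_iff_mem.2 (Ideal.mul_mem_right _ _ (ham hr))
    let e := (LC0equiv a (R ⧸ IsLocalRing.maximalIdeal R)).trans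
      ((LinearEquiv.ofEq _ _ htop).trans Submodule.topEquiv)
    exact Module.Finite.equiv (e.symm.congrLeft E R)
  | succ n ih =>
    intro P hP h
    by_cases hJ : a ≤ P
    · have := LC_le_zero a hJ n
      infer_instance
    obtain ⟨x, hxa, hxP⟩ := Set.not_subset.1 hJ
    obtain ⟨δ, hδ⟩ := PX_delta a hxP n
    have hf : Module.Finite R (LC a n (PX P x) →ₗ[R] E) := dual_fg_filt a E n _ fun q hq hle =>
      ih q hq (dim_step (PX_prime hxP hle).1 h)
    have hN : IsNoetherian R (LC a n (PX P x) →ₗ[R] E) := isNoetherian_of_isNoetherianRing_of_finite R _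
    let δs : (LC a (n+1) (R ⧸ P) →ₗ[R] E) →ₗ[R] (LC a n (PX P x) →ₗ[R] E) := LinearMap.lcomp R E δ
    have hr : Module.Finite R (LinearMap.range δs) := inferInstance
    obtain ⟨k, s, hs⟩ := Module.Finite.exists_fin (R := R) (M := LinearMap.range δs)
    have hd : ∀ j, ∃ d, δs d = s j := fun j => (s j).2
    choose d hd using hd
    refine complete_fg (IsLocalRing.maximalIdeal R) (x := x) (IsLocalRing.le_maximalIdeal ha hxa) _ k d ?_ ?_
    · intro φ
      have h1 : (⟨δs φ, φ, rfl⟩ : LinearMap.range δs) ∈ Submodule.span R (Set.range s) := hs ▸ Submodule.mem_top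
      obtain ⟨c, hc⟩ := (Submodule.mem_span_range_iff_exists_fun R).1 h1
      have hc' : ∑ j, c j • δs (d j) = δs φ := by
        have := congrArg (LinearMap.range δs).subtype hc
        rw [map_sum] at this
        simp only [map_smul] at this
        simp only [hd]
        exact this
      have h2 : δs (φ - ∑ j, c j • d j) = 0 := by
        rw [map_sub, map_sum, sub_eq_zero, ← hc']
        simp only [map_smul]
      obtain ⟨θ, hθ⟩ := inj_ext (x • (LinearMap.id : LC a (n+1) (R ⧸ P) →ₗ[R] _)) (φ - ∑ j, c j • d j) (by
        intro y hy
        obtain ⟨z, rfl⟩ := (hδ y).1 hy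
        exact LinearMap.congr_fun h2 z)
      refine ⟨c, θ, ?_⟩
      rw [← sub_eq_iff_eq_add', ← hθ]
      ext y
      simp
    · intro φ hφ
      ext y
      obtain ⟨t, ht⟩ := LC_pow_tors a y hxa
      obtain ⟨θ, rfl⟩ := hφ t
      rw [LinearMap.smul_apply, ← map_smul, ht, map_zero, LinearMap.zero_apply]

end part7

section part8
set_option linter.unusedSectionVars false

variable {R : Type u} [CommRing R] [IsNoetherianRing R] (a : Ideal R)

lemma LC_ann {X : Type u} [AddCommGroup X] [Module R X] (i : ℕ) {r : R} (hr : r ∈ Module.annihilator R X)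
    (z : LC a i X) : r • z = 0 := by
  rw [← LCmap_smul a i r z]
  have : r • (LinearMap.id : X →ₗ[R] X) = 0 := by
    ext x
    exact Module.mem_annihilator.1 hr x
  rw [this, LCmap_zero]

lemma LC_surj_top {P : Ideal R} [P.IsPrime] {x : R} (hx : x ∉ P) (n : ℕ)
    (h : ringKrullDim (R ⧸ P) < (n + 1 : ℕ)) (y : LC a n (R ⧸ P)) : ∃ z, x • z = y := by
  refine PX_surj a hx n (GV a n _ fun q hq hle => ?_) y
  exact dim_step (PX_prime hx hle).1 h

lemma kill_filt (q : Ideal R) [q.IsPrime] (i : ℕ) (M : Type u) [AddCommGroup M] [Module R M] [Module.Finite R M]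
    (h : ∀ q' : Ideal R, q'.IsPrime → Module.annihilator R M ≤ q' → ∃ s ∉ q, ∀ z : LC a i (R ⧸ q'), s • z = 0) :
    ∃ s ∉ q, ∀ z : LC a i M, s • z = 0 := by
  refine filt (R := R) (fun X _ _ => ∃ s ∉ q, ∀ z : LC a i X, s • z = 0) ?_ ?_ ?_ M h
  · intro X _ _ hX
    have := LC_sub_of_sub a X i hX
    exact ⟨1, (Ideal.ne_top_iff_one q).1 (Ideal.IsPrime.ne_top inferInstance),
      fun z => Subsingleton.elim _ _⟩
  · rintro X Y _ _ _ _ e ⟨s, hs, hX⟩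
    refine ⟨s, hs, fun z => ?_⟩
    obtain ⟨z, rfl⟩ := (LCequiv a i e).surjective z
    rw [← map_smul, hX, map_zero]
  · rintro X Y Z _ _ _ _ _ _ f g hf hg hfg ⟨s1, hs1, h1⟩ ⟨s3, hs3, h3⟩
    refine ⟨s1 * s3, fun hm => ?_, fun z => ?_⟩
    · exact (Ideal.IsPrime.mem_or_mem inferInstance hm).elim hs1 hs3
    · obtain ⟨w, hw⟩ := (LC_half a f g hf hg hfg i (s3 • z)).1 (by rw [map_smul, h3])
      rw [mul_smul, ← hw, ← map_smul, h1, map_zero]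

lemma CH_kill (D : Type u) [AddCommGroup D] [Module R D] [Module.Finite R D] (q : Ideal R) [q.IsPrime]
    {s y : R} (hs : s ∉ q) (hy : y ∈ q) (h : ∀ φ : D, ∃ θ, s • φ = y • θ) :
    ∃ w ∉ q, ∀ φ : D, w • φ = 0 := by
  obtain ⟨p, hp, -, hc, h0⟩ := LinearMap.exists_monic_and_natDegree_eq_and_coeff_mem_pow_and_aeval_eq_zero R
    (algebraMap R (Module.End R D) s) (Ideal.span {y}) (by
      rintro _ ⟨φ, rfl⟩
      obtain ⟨θ, hθ⟩ := h φ
      change s • φ ∈ _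
      rw [hθ]
      exact Submodule.smul_mem_smul (Ideal.mem_span_singleton_self y) Submodule.mem_top)
  refine ⟨p.eval s, fun hm => ?_, fun φ => ?_⟩
  · apply hs
    rw [Polynomial.eval_eq_sum_range, Finset.sum_range_succ, hp.coeff_natDegree, one_mul] at hm
    have h1 : ∑ k ∈ Finset.range p.natDegree, p.coeff k * s ^ k ∈ q := by
      refine Ideal.sum_mem _ fun k hk => Ideal.mul_mem_right _ _ ?_
      have h2 := hc k
      have h3 := Ideal.pow_le_self (I := Ideal.span {y}) (n := p.natDegree - k)
        (by have := Finset.mem_range.1 hk; omega) h2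
      exact (Ideal.span_singleton_le_iff_mem _).2 hy h3
    have h4 := (Ideal.add_mem_iff_right _ h1).1 hm
    exact Ideal.IsPrime.mem_of_pow_mem inferInstance _ h4
  · rw [Polynomial.aeval_algebraMap_apply] at h0
    have := LinearMap.congr_fun h0 φ
    simpa using this

variable [IsLocalRing R] [IsAdicComplete (IsLocalRing.maximalIdeal R) R]

/-- Lichtenbaum–Hartshorne vanishing. -/
theorem LH (p : Ideal R) [hp : p.IsPrime] (hap : a ≤ p) (hpm : p ≠ IsLocalRing.maximalIdeal R) (n : ℕ) :
    ∀ P : Ideal R, P.IsPrime → P ≤ p → ringKrullDim (R ⧸ P) < (n + 1 : ℕ) →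
      Subsingleton (LC a n (R ⧸ P)) := by
  have ha : a ≠ ⊤ := fun h => hp.ne_top (top_le_iff.1 (h ▸ hap))
  obtain ⟨E, _, _, f, hf, hE, hEf⟩ := hull_k (R := R)
  induction n with
  | zero =>
    intro P hP hPp h
    obtain rfl := eq_max_of_dim (by simpa using h)
    exact absurd (le_antisymm (IsLocalRing.le_maximalIdeal hp.ne_top) hPp) hpm
  | succ n ih =>
    intro P hP hPp h
    by_cases hJ : a ≤ P
    · exact LC_le_zero a hJ n
    obtain ⟨y, hya, hyP⟩ := Set.not_subset.1 hJ
    have hle : P ⊔ Ideal.span {y} ≤ p :=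
      sup_le hPp ((Ideal.span_singleton_le_iff_mem _).2 (hap hya))
    obtain ⟨q, hq, hqp⟩ := Ideal.exists_minimalPrimes_le hle
    have hqP : q.IsPrime := hq.1.1
    have hyq : y ∈ q := hq.1.2 (Ideal.mem_sup_right (Ideal.mem_span_singleton_self y))
    have hPq : P ≤ q := le_sup_left.trans hq.1.2
    have hPq' : P < q := lt_of_le_of_ne hPq (fun e => hyP (e ▸ hyq))
    obtain ⟨δ, hδ⟩ := PX_delta a hyP n
    obtain ⟨s, hsq, hs⟩ : ∃ s ∉ q, ∀ z : LC a n (PX P y), s • z = 0 := by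
      refine kill_filt a q n _ fun q' hq' hle' => ?_
      by_cases hqq : q' ≤ q
      · have h2 : q' = q := le_antisymm hqq (hq.2 ⟨hq', (PX_ann P y).trans hle'⟩ hqq)
        subst h2
        have := ih q' hq' hqp (dim_step hPq' h)
        exact ⟨1, (Ideal.ne_top_iff_one _).1 hq'.ne_top, fun z => Subsingleton.elim _ _⟩
      · obtain ⟨s, hs1, hs2⟩ := Set.not_subset.1 hqq
        exact ⟨s, hs2, fun z => LC_ann a n (by rwa [Ideal.annihilator_quotient]) z⟩
    have hD : Module.Finite R (LC a (n+1) (R ⧸ P) →ₗ[R] E) := dual_fg a E ha hEf (n+1) P hP h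
    obtain ⟨w, hw, hwD⟩ := CH_kill (LC a (n+1) (R ⧸ P) →ₗ[R] E) q hsq hyq (by
      intro φ
      obtain ⟨θ, hθ⟩ := inj_ext (y • (LinearMap.id : LC a (n+1) (R ⧸ P) →ₗ[R] _)) (s • φ) (by
        intro z hz
        obtain ⟨u, rfl⟩ := (hδ z).1 hz
        rw [LinearMap.mem_ker, LinearMap.smul_apply, ← map_smul, ← map_smul, hs, map_zero, map_zero])
      refine ⟨θ, ?_⟩
      rw [← hθ]
      ext z
      simp)
    refine hom_faithful E f hf _ fun φ => ?_
    ext z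
    obtain ⟨z, rfl⟩ := LC_surj_top a (fun h => hw (hPq h)) (n+1) h z
    rw [map_smul, ← LinearMap.smul_apply, hwD]
    rfl

end part8

section part9
set_option linter.unusedSectionVars false

variable {R : Type u} [CommRing R] [IsNoetherianRing R] (a : Ideal R)

/-- All primes in the support have coheight at most `n`. -/
def DimLE (R : Type u) [CommRing R] (n : ℕ) (M : Type u) [AddCommGroup M] [Module R M] : Prop :=
  ∀ q : Ideal R, q.IsPrime → Module.annihilator R M ≤ q → ringKrullDim (R ⧸ q) < (n + 1 : ℕ)

lemma LC_right {X Y : Type u} [AddCommGroup X] [Module R X] [AddCommGroup Y] [Module R Y]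
    [Module.Finite R X] (f : X →ₗ[R] Y) (hf : Function.Surjective f) (n : ℕ) (h : DimLE R n X) :
    Function.Surjective (LCmap a n f) := by
  obtain ⟨δ, h1, -⟩ := LC_les a (LinearMap.ker f).subtype f (Submodule.subtype_injective _) hf
    (LinearMap.exact_subtype_ker_map f) n
  have h0 : Subsingleton (LC a (n+1) (LinearMap.ker f)) := GV a (n+1) _ fun q hq hle =>
    h q hq ((LinearMap.annihilator_le_of_injective _ (Submodule.subtype_injective _)).trans hle)
  intro y
  exact (h1 y).1 (Subsingleton.elim _ _)

lemma LCmap_sum {X Y : Type u} [AddCommGroup X] [Module R X] [AddCommGroup Y] [Module R Y]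
    {ι : Type} (s : Finset ι) (f : ι → X →ₗ[R] Y) (n : ℕ) (x : LC a n X) :
    LCmap a n (∑ i ∈ s, f i) x = ∑ i ∈ s, LCmap a n (f i) x := by
  classical
  induction s using Finset.induction_on with
  | empty => simp [LCmap_zero]
  | insert i s hi ih => rw [Finset.sum_insert hi, Finset.sum_insert hi, LCmap_add, ih]

lemma LC_quot_ideal (p : Ideal R) (M : Type u) [AddCommGroup M] [Module R M] [Module.Finite R M]
    (n : ℕ) (hM : DimLE R n M)
    (h0 : Subsingleton (LC a n (M ⧸ (p • ⊤ : Submodule R M)))) (t : LC a n M) :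
    t ∈ (p • ⊤ : Submodule R (LC a n M)) := by
  obtain ⟨k, r, hr⟩ := Submodule.fg_iff_exists_fin_generating_family.1 (IsNoetherian.noetherian p)
  let V : Submodule R M := p • ⊤
  let π : (Fin k → M) →ₗ[R] M := ∑ i, r i • LinearMap.proj i
  have hrp : ∀ i, r i ∈ p := fun i => hr ▸ Submodule.subset_span ⟨i, rfl⟩
  have hπ : ∀ w, π w = ∑ i, r i • w i := fun w => by simp [π]
  have hπV : ∀ w, π w ∈ V := fun w => by
    rw [hπ]
    exact Submodule.sum_mem _ fun i _ => Submodule.smul_mem_smul (hrp i) Submodule.mem_top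
  let π' : (Fin k → M) →ₗ[R] V := π.codRestrict V hπV
  have hsurj : Function.Surjective π' := by
    rw [← LinearMap.range_eq_top, eq_top_iff]
    rintro ⟨v, hv⟩ -
    have : v ∈ LinearMap.range π := by
      refine Submodule.smul_induction_on hv ?_ (fun x y hx hy => Submodule.add_mem _ hx hy)
      intro c hc m _
      rw [← hr] at hc
      obtain ⟨d, rfl⟩ := (Submodule.mem_span_range_iff_exists_fun R).1 hc
      refine ⟨fun i => d i • m, ?_⟩
      rw [hπ, Finset.sum_smul]
      refine Finset.sum_congr rfl fun i _ => ?_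
      rw [smul_smul, smul_eq_mul, mul_comm]
    obtain ⟨w, hw⟩ := this
    exact ⟨w, Subtype.ext hw⟩
  obtain ⟨z, hz⟩ := (LC_half a V.subtype V.mkQ V.injective_subtype V.mkQ_surjective
    (LinearMap.exact_subtype_mkQ V) n t).1 (Subsingleton.elim (α := LC a n (M ⧸ V)) _ _)
  have hF : DimLE R n (Fin k → M) := by
    intro q hq hle
    refine hM q hq (le_trans ?_ hle)
    intro c hc
    rw [Module.mem_annihilator] at hc ⊢
    intro w
    funext i
    exact hc (w i)
  obtain ⟨w, rfl⟩ := LC_right a π' hsurj n hF z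
  have h1 : LCmap a n π w = t := by
    rw [← hz, ← LinearMap.comp_apply, ← LCmap_comp]
    rfl
  rw [← h1, LCmap_sum]
  refine Submodule.sum_mem _ fun i _ => ?_
  have h2 : (r i • LinearMap.proj i : (Fin k → M) →ₗ[R] M) = (r i • LinearMap.id) ∘ₗ LinearMap.proj i := rfl
  rw [h2, LCmap_comp, LinearMap.comp_apply, LCmap_smul]
  exact Submodule.smul_mem_smul (hrp i) Submodule.mem_top

lemma att_ann {M : Type u} [AddCommGroup M] [Module R M] (n : ℕ) {p : Ideal R} (hp : p ∈ Att R (LC a n M)) :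
    Module.annihilator R M ≤ p := by
  obtain ⟨-, U, rfl⟩ := hp
  intro r hr
  rw [Module.mem_annihilator]
  intro z
  obtain ⟨z, rfl⟩ := Submodule.mkQ_surjective _ z
  rw [← map_smul, LC_ann a n hr, map_zero]

lemma exists_map (M : Type u) [AddCommGroup M] [Module R M] [Module.Finite R M] (q : Ideal R) [hq : q.IsPrime]
    (hle : Module.annihilator R M ≤ q)
    (hmin : ∀ q' : Ideal R, q'.IsPrime → Module.annihilator R M ≤ q' → q' ≤ q → q' = q) :
    ∃ ψ : M →ₗ[R] (R ⧸ q), ψ ≠ 0 := by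
  have hwf : WellFoundedGT (Submodule R M) := isNoetherian_iff'.1 inferInstance
  obtain ⟨K, hK, hKmax⟩ := hwf.wf.has_min {K : Submodule R M | Module.annihilator R (M ⧸ K) ≤ q}
    ⟨⊥, by
      change Module.annihilator R (M ⧸ (⊥ : Submodule R M)) ≤ q
      rwa [(Submodule.quotEquivOfEqBot (⊥ : Submodule R M) rfl).annihilator_eq]⟩
  change Module.annihilator R (M ⧸ K) ≤ q at hK
  have hMK : Module.annihilator R M ≤ Module.annihilator R (M ⧸ K) :=
    LinearMap.annihilator_le_of_surjective K.mkQ K.mkQ_surjective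
  have hqmin : q ∈ (Module.annihilator R (M ⧸ K)).minimalPrimes := by
    refine ⟨⟨hq, hK⟩, fun q' hq' hqq => ?_⟩
    exact (hmin q' hq'.1 (hMK.trans hq'.2) hqq).ge
  have hass := Module.associatedPrimes.minimalPrimes_annihilator_subset_associatedPrimes R (M ⧸ K) hqmin
  obtain ⟨-, ι, hι⟩ := (isAssociatedPrime_iff_exists_injective_linearMap q (M ⧸ K)).1 hass
  let K' := (LinearMap.range ι).comap K.mkQ
  have hι1 : ι 1 ≠ 0 := by
    intro h
    rw [← map_zero ι] at h
    exact one_ne_zero (hι h)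
  have hKK : K < K' := by
    refine lt_of_le_of_ne ?_ ?_
    · intro x hx
      change K.mkQ x ∈ LinearMap.range ι
      rw [show K.mkQ x = 0 from (Submodule.Quotient.mk_eq_zero _).2 hx]
      exact zero_mem _
    · intro h
      obtain ⟨x, hx⟩ := K.mkQ_surjective (ι 1)
      have : x ∈ K' := by
        change K.mkQ x ∈ LinearMap.range ι
        rw [hx]
        exact ⟨1, rfl⟩
      rw [← h] at this
      apply hι1
      rw [← hx]
      exact (Submodule.Quotient.mk_eq_zero _).2 this
  have h3 : ¬ Module.annihilator R (M ⧸ K') ≤ q := fun h => hKmax K' h hKK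
  obtain ⟨s, hs, hsq⟩ := Set.not_subset.1 h3
  have hs' : ∀ x, (s • K.mkQ) x ∈ LinearMap.range ι := by
    intro x
    have h4 := Module.mem_annihilator.1 hs (K'.mkQ x)
    rw [← map_smul] at h4
    have h5 : s • x ∈ K' := (Submodule.Quotient.mk_eq_zero _).1 h4
    change K.mkQ (s • x) ∈ LinearMap.range ι at h5
    rwa [map_smul] at h5
  let e := LinearEquiv.ofInjective ι hι
  refine ⟨e.symm.toLinearMap ∘ₗ (s • K.mkQ).codRestrict _ hs', fun h => ?_⟩
  obtain ⟨x, hx⟩ := K.mkQ_surjective (ι 1)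
  have h6 := LinearMap.congr_fun h x
  have h7 : (s • K.mkQ).codRestrict (LinearMap.range ι) hs' x = 0 := by
    apply e.symm.injective
    rw [map_zero]
    exact h6
  have h8 : s • K.mkQ x = 0 := congrArg Subtype.val h7
  rw [hx, ← map_smul, ← map_zero ι] at h8
  have h9 := hι h8
  apply hsq
  rw [Algebra.smul_def, mul_one] at h9
  exact Ideal.Quotient.eq_zero_iff_mem.1 h9

lemma mem_att (M : Type u) [AddCommGroup M] [Module R M] [Module.Finite R M] (n : ℕ) (hM : DimLE R n M)
    (q : Ideal R) [hq : q.IsPrime] (hle : Module.annihilator R M ≤ q)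
    (hne : ¬ Subsingleton (LC a n (R ⧸ q))) : q ∈ Att R (LC a n M) := by
  have hmin : ∀ q' : Ideal R, q'.IsPrime → Module.annihilator R M ≤ q' → q' ≤ q → q' = q := by
    intro q' hq' h1 h2
    by_contra h3
    exact hne (GVp a n q hq (dim_step (lt_of_le_of_ne h2 h3) (hM q' hq' h1)))
  obtain ⟨ψ, hψ⟩ := exists_map M q hle hmin
  have h1 : Function.Surjective (LCmap a n ψ.rangeRestrict) :=
    LC_right a _ ψ.surjective_rangeRestrict n hM
  let V := LinearMap.range ψ
  have h2 : Subsingleton (LC a n ((R ⧸ q) ⧸ V)) := by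
    refine GV a n _ fun q' hq' hle' => ?_
    have hqq : q ≤ q' := by
      refine le_trans ?_ hle'
      have := LinearMap.annihilator_le_of_surjective V.mkQ V.mkQ_surjective
      rwa [Ideal.annihilator_quotient] at this
    have hne' : q ≠ q' := by
      intro h
      apply hψ
      ext x
      obtain ⟨y, hy⟩ := Ideal.Quotient.mk_surjective (ψ x)
      have hy' : y ∈ q := by
        rw [h]
        apply hle'
        rw [Module.mem_annihilator]
        intro z
        obtain ⟨z, rfl⟩ := V.mkQ_surjective z
        obtain ⟨z, rfl⟩ := Ideal.Quotient.mk_surjective z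
        rw [← map_smul]
        refine (Submodule.Quotient.mk_eq_zero _).2 ⟨z • x, ?_⟩
        rw [map_smul, ← hy]
        change Ideal.Quotient.mk q (z * y) = Ideal.Quotient.mk q (y * z)
        rw [mul_comm]
      rw [← hy]
      exact Ideal.Quotient.eq_zero_iff_mem.2 hy'
    exact dim_step (lt_of_le_of_ne hqq hne') (hM q hq hle)
  have h3 : Function.Surjective (LCmap a n V.subtype) := fun y =>
    (LC_half a V.subtype V.mkQ V.injective_subtype V.mkQ_surjective
      (LinearMap.exact_subtype_mkQ V) n y).1 (Subsingleton.elim _ _)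
  have h4 : Function.Surjective (LCmap a n ψ) := by
    have : LCmap a n ψ = LCmap a n V.subtype ∘ₗ LCmap a n ψ.rangeRestrict := by
      rw [← LCmap_comp]
      rfl
    rw [this]
    exact h3.comp h1
  refine ⟨hq, LinearMap.ker (LCmap a n ψ), ?_⟩
  rw [((LCmap a n ψ).quotKerEquivOfSurjective h4).annihilator_eq]
  apply le_antisymm
  · intro r hr
    rw [Module.mem_annihilator]
    exact fun z => LC_ann a n (by rwa [Ideal.annihilator_quotient]) z
  · intro r hr
    by_contra hrq
    apply hne
    refine subsingleton_of_forall_eq 0 fun y => ?_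
    obtain ⟨z, rfl⟩ := LC_surj_top a hrq n (hM q hq hle) y
    exact Module.mem_annihilator.1 hr z

variable [IsLocalRing R] [IsAdicComplete (IsLocalRing.maximalIdeal R) R]

lemma att_max (M : Type u) [AddCommGroup M] [Module R M] [Module.Finite R M] (n : ℕ) (hM : DimLE R n M)
    {p : Ideal R} (hp : p ∈ Att R (LC a n M)) (p' : Ideal R) [hp' : p'.IsPrime] (hap : a ≤ p') (hpp : p ≤ p') :
    p' = IsLocalRing.maximalIdeal R := by
  by_contra hne
  have hann := att_ann a n hp
  obtain ⟨hpP, U, hU⟩ := hp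
  have hd := hM p hpP hann
  have h0 : Subsingleton (LC a n (M ⧸ (p • ⊤ : Submodule R M))) := by
    refine LC_filt a n _ fun q hq hle => ?_
    have hpq : p ≤ q := by
      refine le_trans ?_ hle
      intro r hr
      rw [Module.mem_annihilator]
      intro z
      obtain ⟨z, rfl⟩ := Submodule.mkQ_surjective _ z
      rw [← map_smul]
      exact (Submodule.Quotient.mk_eq_zero _).2 (Submodule.smul_mem_smul hr Submodule.mem_top)
    rcases hpq.eq_or_lt with rfl | hlt
    · exact LH a p' hap hne n p hq hpp hd
    · exact GVp a n q hq (dim_step hlt hd)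
  have h1 := LC_quot_ideal a p M n hM h0
  have h2 : ∀ t, t ∈ U := by
    intro t
    refine Submodule.smul_induction_on (h1 t) ?_ (fun x y hx hy => U.add_mem hx hy)
    intro r hr z _
    rw [hU, Module.mem_annihilator] at hr
    have := hr (U.mkQ z)
    rw [← map_smul] at this
    exact (Submodule.Quotient.mk_eq_zero _).1 this
  apply hpP.ne_top
  rw [hU, eq_top_iff]
  intro r _
  rw [Module.mem_annihilator]
  intro z
  obtain ⟨z, rfl⟩ := Submodule.mkQ_surjective _ z
  rw [← map_smul]
  exact (Submodule.Quotient.mk_eq_zero _).2 (h2 _)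

end part9

theorem stmt17 (R : Type u) [CommRing R] [IsNoetherianRing R] [IsLocalRing R]
    [IsAdicComplete (IsLocalRing.maximalIdeal R) R]
    (a : Ideal R) (ha : a ≠ ⊤)
    (M : Type u) [AddCommGroup M] [Module R M] [Module.Finite R M]
    (n : ℕ) (hdim : mdim R M = (n : ℕ∞)) (hne : Nontrivial (LC a n M))
    (N : Submodule R M)
    (h1 : associatedPrimes R (M ⧸ N) = Att R (LC a n M))
    (h2 : associatedPrimes R N = associatedPrimes R M \ Att R (LC a n M)) :
    (a ⊔ Module.annihilator R (M ⧸ N)).radical = IsLocalRing.maximalIdeal R ∧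
      Nonempty ((LC a n M) ≃ₗ[R] (LC (IsLocalRing.maximalIdeal R) n (M ⧸ N))) := by
  have hM : DimLE R n M := by
    intro q hq hle
    have h3 : ringKrullDim (R ⧸ Module.annihilator R M) = (n : ℕ∞) := by
      rw [← Module.supportDim_eq_ringKrullDim_quotient_annihilator]
      exact hdim
    have h4 : ringKrullDim (R ⧸ q) ≤ ringKrullDim (R ⧸ Module.annihilator R M) :=
      ringKrullDim_le_of_surjective (Ideal.Quotient.factor hle) (Ideal.Quotient.factor_surjective hle)
    rw [h3] at h4
    refine h4.trans_lt ?_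
    exact_mod_cast Nat.lt_succ_self n
  have hN0 : Subsingleton (LC a n N) := by
    refine LC_filt a n _ fun q hq hle => ?_
    by_contra hns
    have hMN : Module.annihilator R M ≤ Module.annihilator R N :=
      LinearMap.annihilator_le_of_injective N.subtype N.injective_subtype
    obtain ⟨q0, hq0, hq0q⟩ := Ideal.exists_minimalPrimes_le hle
    have hq0P : q0.IsPrime := hq0.1.1
    rcases hq0q.eq_or_lt with rfl | hlt
    · have hass := Module.associatedPrimes.minimalPrimes_annihilator_subset_associatedPrimes R N hq0
      rw [h2] at hass
      exact hass.2 (mem_att a M n hM q0 (hMN.trans hle) hns)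
    · exact hns (GVp a n q hq (dim_step hlt (hM q0 hq0P (hMN.trans hq0.1.2))))
  have hinj : Function.Injective (LCmap a n N.mkQ) := by
    rw [injective_iff_map_eq_zero]
    intro y hy
    obtain ⟨z, rfl⟩ := (LC_half a N.subtype N.mkQ N.injective_subtype N.mkQ_surjective
      (LinearMap.exact_subtype_mkQ N) n y).1 hy
    rw [Subsingleton.elim z 0, map_zero]
  have hsurj : Function.Surjective (LCmap a n N.mkQ) := LC_right a _ N.mkQ_surjective n hM
  let e1 : (LC a n M) ≃ₗ[R] (LC a n (M ⧸ N)) := LinearEquiv.ofBijective _ ⟨hinj, hsurj⟩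
  have hnt : Nontrivial (M ⧸ N) := by
    by_contra hn
    rw [not_nontrivial_iff_subsingleton] at hn
    have h3 := LC_sub_of_sub a (M ⧸ N) n hn
    have h4 : Subsingleton (LC a n M) := e1.toEquiv.subsingleton
    exact not_subsingleton (LC a n M) h4
  have hrad : (a ⊔ Module.annihilator R (M ⧸ N)).radical = IsLocalRing.maximalIdeal R := by
    apply le_antisymm
    · refine (Ideal.IsPrime.radical_le_iff inferInstance).2 (sup_le (IsLocalRing.le_maximalIdeal ha) ?_)
      refine IsLocalRing.le_maximalIdeal fun h => ?_
      rw [Module.annihilator_eq_top_iff] at h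
      exact not_subsingleton (M ⧸ N) h
    · rw [Ideal.radical_eq_sInf]
      refine le_sInf fun p' hp' => ?_
      have hp'P : p'.IsPrime := hp'.2
      obtain ⟨q0, hq0, hq0q⟩ := Ideal.exists_minimalPrimes_le (le_sup_right.trans hp'.1)
      have hass := Module.associatedPrimes.minimalPrimes_annihilator_subset_associatedPrimes R (M ⧸ N) hq0
      rw [h1] at hass
      exact (att_max a M n hM hass p' (le_sup_left.trans hp'.1) hq0q).ge
  refine ⟨hrad, ?_⟩
  obtain ⟨e2⟩ := LC_sup (Module.annihilator R (M ⧸ N)) a n (M ⧸ N)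
    (fun r hr x => Module.mem_annihilator.1 hr x)
  have hrad' : (a ⊔ Module.annihilator R (M ⧸ N)).radical = (IsLocalRing.maximalIdeal R).radical := by
    rw [hrad, Ideal.IsPrime.radical inferInstance]
  let e3 : (LC (a ⊔ Module.annihilator R (M ⧸ N)) n (M ⧸ N)) ≃ₗ[R]
      (LC (IsLocalRing.maximalIdeal R) n (M ⧸ N)) :=
    ((localCohomology.isoOfSameRadical hrad' n).app (ModuleCat.of R (M ⧸ N))).toLinearEquiv
  exact ⟨e1.trans (e2.trans e3)⟩

end
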